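/- arXiv:2401.16602 — 2 statements merged into one kernel-verified Lean document; each statement's English description precedes it below -/
import Mathlib

section
/- Let ℓ be a field of characteristic ≠ 2 such that ℓ satisfies property 𝒜_i(2) for some integer i ≥ 0 and u(ℓ) = 2^i. For any integer r ≥ 1 let L_r = ℓ(x_1, …, x_r), and for r ≥ 2 let V_r be the set of non-trivial discrete valuations on L_r that are trivial on L_{r-1}. Then for every r ≥ 2 and every integer n with 0 ≤ n < 2^{i+r-2}, there exists a (2^{i+r} − n)-dimensional quadratic form q over L_r that is anisotropic over L_r but satisfies i_W(q_{(L_r)_v}) ≥ 2^{i+r-2} − n for every v ∈ V_r; i.e., q violates LGP(2^{i+r-2} − n, 1) with respect to V_r. -/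
/-!  Diagonal quadratic forms over a field of characteristic ≠ 2.
In characteristic ≠ 2 every regular quadratic form is isometric to a diagonal form
`⟨d 1, …, d n⟩`, so we model (regular) quadratic forms by their diagonal
coefficient functions. -/

/-- The diagonal quadratic form `⟨d i⟩_{i : ι}` over `k`. -/
noncomputable def diagQF (k : Type) [Field k] {ι : Type} [Fintype ι] (d : ι → k) :
    QuadraticForm k (ι → k) :=
  QuadraticMap.weightedSumSquares k d

/-- Isometry of (diagonal) quadratic forms. -/
def FormIsom (k : Type) [Field k] {ι κ : Type} [Fintype ι] [Fintype κ]
    (d : ι → k) (e : κ → k) : Prop :=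
  QuadraticMap.Equivalent (diagQF k d) (diagQF k e)

/-- The orthogonal sum of `m` copies of the hyperbolic plane `⟨1, -1⟩`. -/
def hypForm (k : Type) [Field k] (m : ℕ) : Fin (2 * m) → k :=
  fun j => if j.val % 2 = 0 then 1 else -1

/-- The Witt index of a (diagonal) form: the largest `m` such that the form is isometric
to `m·ℍ ⟂ (rest)` for some diagonal form `rest`. -/
noncomputable def wittIndex (k : Type) [Field k] {ι : Type} [Fintype ι] (d : ι → k) : ℕ :=
  sSup {m : ℕ | ∃ (s : ℕ) (e : Fin s → k), FormIsom k d (Sum.elim (hypForm k m) e)}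
/-- The u-invariant of a field: the supremum of the dimensions of anisotropic regular
quadratic forms over `k` (`⊤` if unbounded). -/
noncomputable def uInv (k : Type) [Field k] : ℕ∞ :=
  sSup {N : ℕ∞ | ∃ n : ℕ, N = n ∧
    ∃ d : Fin n → k, (∀ t, d t ≠ 0) ∧ (diagQF k d).Anisotropic}

/-- The refined m-invariant `m_{i,j}(k)`: the least dimension (`⊤` if there is none) of a
regular quadratic form `q` of dimension ≥ 1 over `k` with `i_W(q) < j` such that
`i_W(q ⟂ σ) ≥ j` for every `i`-dimensional regular form `σ` over `k`. -/
noncomputable def mInv (k : Type) [Field k] (i j : ℕ) : ℕ∞ :=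
  sInf {N : ℕ∞ | ∃ n : ℕ, N = n ∧ 1 ≤ n ∧
    ∃ d : Fin n → k, (∀ t, d t ≠ 0) ∧ wittIndex k d < j ∧
      ∀ σ : Fin i → k, (∀ t, σ t ≠ 0) → j ≤ wittIndex k (Sum.elim d σ)}
/-- The value group of (normalized) discrete valuations. -/
abbrev Zm0 : Type := WithZero (Multiplicative ℤ)

/-- A (discrete, i.e. `ℤₘ₀`-valued) valuation is non-trivial if it takes a value other
than 0 and 1. -/
def isNontrivialVal {k : Type} [Field k] (v : Valuation k Zm0) : Prop :=
  ∃ x : k, v x ≠ 0 ∧ v x ≠ 1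

/-- The completion `k_v` of a field `k` with respect to a discrete valuation `v`. -/
noncomputable def valCompletion {k : Type} [Field k] (v : Valuation k Zm0) : Type :=
  letI := Valued.mk' v
  UniformSpace.Completion k

noncomputable instance valCompletion.instField {k : Type} [Field k] (v : Valuation k Zm0) :
    Field (valCompletion v) :=
  letI := Valued.mk' v
  UniformSpace.Completion.instField

/-- The canonical embedding of a field into its `v`-adic completion. -/
noncomputable def toValCompletion {k : Type} [Field k] (v : Valuation k Zm0) :
    k →+* valCompletion v :=
  letI := Valued.mk' v
  UniformSpace.Completion.coeRingHom

/-- A quadratic form `q` over `k` satisfies `LGP(r, s)` with respect to a set `V` of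
discrete valuations on `k` if `i_W(q_{k_v}) ≥ r` for all `v ∈ V` implies `i_W(q) ≥ s`. -/
def satisfiesLGP {k : Type} [Field k] (V : Set (Valuation k Zm0)) {ι : Type} [Fintype ι]
    (d : ι → k) (r s : ℕ) : Prop :=
  (∀ v ∈ V, r ≤ wittIndex (valCompletion v) (toValCompletion v ∘ d)) → s ≤ wittIndex k d
/-- Property `𝒜_i(2)`: every system of `s` quadratic forms (homogeneous quadratic
polynomials) over `ℓ` in `n > s·2^i` common variables has a non-trivial simultaneous zero
in some odd degree (finite) field extension of `ℓ`. -/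
def propertyA (ℓ : Type) [Field ℓ] (i : ℕ) : Prop :=
  ∀ (s n : ℕ) (P : Fin s → MvPolynomial (Fin n) ℓ),
    (∀ t, (P t).IsHomogeneous 2) → s * 2 ^ i < n →
    ∃ (L : Type) (_ : Field L) (_ : Algebra ℓ L),
      FiniteDimensional ℓ L ∧ Odd (Module.finrank ℓ L) ∧
      ∃ x : Fin n → L, x ≠ 0 ∧ ∀ t, MvPolynomial.aeval x (P t) = 0
/-- The rational function field `ℓ(x₁, …, x_r)`, modeled as the fraction field of the
polynomial ring in `r` variables. -/
noncomputable abbrev Lfield (ℓ : Type) [Field ℓ] (r : ℕ) : Type :=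
  FractionRing (MvPolynomial (Fin r) ℓ)


def AnisoR {R : Type*} [CommRing R] {ι : Type*} [Fintype ι] (d : ι → R) : Prop :=
  ∀ w : ι → R, ∑ j, d j * w j ^ 2 = 0 → w = 0

lemma anisoR_step {R S : Type*} [CommRing R] [IsDomain R] [CommRing S] (ρ : R →+* S) (p : R)
    (hp : p ≠ 0) (hp0 : ρ p = 0) (hker : ∀ x, ρ x = 0 → p ∣ x)
    (hinf : ∀ x, (∀ n, p ^ n ∣ x) → x = 0) {ι κ : Type*} [Fintype ι] [Fintype κ]
    (a : ι → R) (b : κ → R) (ha : AnisoR (fun j => ρ (a j))) (hb : AnisoR (fun j => ρ (b j))) :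
    AnisoR (Sum.elim a (fun j => p * b j)) := by
  have key : ∀ n : ℕ, ∀ (w : ι → R) (z : κ → R),
      ∑ j, a j * w j ^ 2 + p * ∑ j, b j * z j ^ 2 = 0 →
      (∀ j, p ^ n ∣ w j) ∧ (∀ j, p ^ n ∣ z j) := by
    intro n
    induction n with
    | zero => intro w z _; simp
    | succ n ih =>
      intro w z h
      have h1 := congrArg ρ h
      simp only [map_add, map_mul, hp0, zero_mul, add_zero, map_sum, map_pow, map_zero] at h1
      have h2 := ha (fun j => ρ (w j)) h1
      have h3 : ∀ j, p ∣ w j := fun j => hker _ (congrFun h2 j)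
      choose w' hw' using h3
      have h4 : ∑ j, b j * z j ^ 2 + p * ∑ j, a j * w' j ^ 2 = 0 := by
        apply mul_left_cancel₀ hp
        rw [mul_zero, ← h, mul_add, add_comm]
        congr 1
        rw [Finset.mul_sum, Finset.mul_sum]
        refine Finset.sum_congr rfl fun j _ => ?_
        rw [hw' j]; ring
      have h5 := congrArg ρ h4
      simp only [map_add, map_mul, hp0, zero_mul, add_zero, map_sum, map_pow, map_zero] at h5
      have h6 := hb (fun j => ρ (z j)) h5
      have h7 : ∀ j, p ∣ z j := fun j => hker _ (congrFun h6 j)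
      choose z' hz' using h7
      have h8 : ∑ j, a j * w' j ^ 2 + p * ∑ j, b j * z' j ^ 2 = 0 := by
        apply mul_left_cancel₀ hp
        rw [mul_zero, ← h4, mul_add, add_comm]
        congr 1
        rw [Finset.mul_sum, Finset.mul_sum]
        refine Finset.sum_congr rfl fun j _ => ?_
        rw [hz' j]; ring
      obtain ⟨i1, i2⟩ := ih w' z' h8
      refine ⟨fun j => ?_, fun j => ?_⟩
      · rw [hw' j, pow_succ']; exact mul_dvd_mul_left _ (i1 j)
      · rw [hz' j, pow_succ']; exact mul_dvd_mul_left _ (i2 j)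
  intro w h
  rw [Fintype.sum_sum_type] at h
  simp only [Sum.elim_inl, Sum.elim_inr, mul_assoc] at h
  rw [← Finset.mul_sum] at h
  funext j
  apply hinf
  intro n
  have := key n _ _ h
  rcases j with j | j
  · exact this.1 j
  · exact this.2 j

lemma anisoR_reindex {R : Type*} [CommRing R] {ι κ : Type*} [Fintype ι] [Fintype κ]
    (d : ι → R) (e : κ → R) (σ : κ → ι) (hσ : Function.Injective σ) (h : ∀ j, e j = d (σ j))
    (hd : AnisoR d) : AnisoR e := by
  classical
  intro w hw
  have := hd (Function.extend σ w 0) (by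
    rw [← hw]
    symm
    apply Finset.sum_of_injOn σ hσ.injOn (by simp)
    · intro j _ hj
      rw [Function.extend_apply' _ _ _ (by simpa using hj)]; simp
    · intro j _
      rw [hσ.extend_apply, h])
  funext j
  have h2 := congrFun this (σ j)
  rwa [hσ.extend_apply] at h2

lemma anisoR_comap {R S : Type*} [CommRing R] [CommRing S] (f : R →+* S)
    (hf : Function.Injective f) {ι : Type*} [Fintype ι] (d : ι → R)
    (h : AnisoR (fun j => f (d j))) : AnisoR d := by
  intro w hw
  have := h (fun j => f (w j)) (by
    have := congrArg f hw; simpa using this)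
  funext j
  exact hf (by simpa using congrFun this j)

lemma anisoR_smul {R : Type*} [CommRing R] [IsDomain R] {ι : Type*} [Fintype ι] (d : ι → R)
    (c : R) (hc : c ≠ 0) (h : AnisoR d) : AnisoR (fun j => c * d j) := by
  intro w hw
  apply h
  apply mul_left_cancel₀ hc
  rw [mul_zero, ← hw, Finset.mul_sum]
  exact Finset.sum_congr rfl fun j _ => by ring

lemma anisoR_poly {R : Type*} [CommRing R] [IsDomain R] {ι : Type*} [Fintype ι] (d : ι → R)
    (h : AnisoR d) : AnisoR (fun j => (Polynomial.C (d j) : Polynomial R)) := by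
  have := anisoR_step (Polynomial.constantCoeff (R := R)) Polynomial.X Polynomial.X_ne_zero (by simp)
    (fun x hx => Polynomial.X_dvd_iff.2 (by simpa using hx)) (fun x hx => by
      ext n
      exact Polynomial.X_pow_dvd_iff.1 (hx (n+1)) n (by omega)) (fun j => Polynomial.C (d j))
      (fun j : Fin 0 => (0 : Polynomial R)) (by simpa using h) (by intro w _; exact Subsingleton.elim _ _)
  exact anisoR_reindex _ _ Sum.inl Sum.inl_injective (fun _ => rfl) this

lemma anisoR_mv {k : Type*} [Field k] {ι : Type*} [Fintype ι] (d : ι → k)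
    (h : AnisoR d) (r : ℕ) : AnisoR (fun j => (MvPolynomial.C (d j) : MvPolynomial (Fin r) k)) := by
  induction r with
  | zero =>
    apply anisoR_comap (MvPolynomial.isEmptyAlgEquiv k (Fin 0)).toRingEquiv.toRingHom
      (MvPolynomial.isEmptyAlgEquiv k (Fin 0)).injective
    convert h using 2 with j
    exact (MvPolynomial.isEmptyAlgEquiv k (Fin 0)).commutes (d j)
  | succ r ih =>
    apply anisoR_comap (MvPolynomial.finSuccEquiv k r).toRingEquiv.toRingHom
      (MvPolynomial.finSuccEquiv k r).injective
    have := anisoR_poly _ ih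
    convert this using 2 with j
    simp [MvPolynomial.finSuccEquiv_apply]

/-- specialization of one variable -/
lemma anisoR_mv_step {k : Type*} [Field k] {r : ℕ} (t : Fin r) (c : k) {ι κ : Type*} [Fintype ι] [Fintype κ]
    (a : ι → MvPolynomial (Fin r) k) (b : κ → MvPolynomial (Fin r) k)
    (ha : AnisoR (fun j => MvPolynomial.aeval (fun s => if s = t then MvPolynomial.C c else (MvPolynomial.X s : MvPolynomial (Fin r) k)) (a j)))
    (hb : AnisoR (fun j => MvPolynomial.aeval (fun s => if s = t then MvPolynomial.C c else (MvPolynomial.X s : MvPolynomial (Fin r) k)) (b j))) :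
    AnisoR (Sum.elim a (fun j => (MvPolynomial.X t - MvPolynomial.C c) * b j)) := by
  set ρ : MvPolynomial (Fin r) k →ₐ[k] MvPolynomial (Fin r) k :=
    MvPolynomial.aeval (fun s => if s = t then MvPolynomial.C c else (MvPolynomial.X s : MvPolynomial (Fin r) k)) with hρ
  have hdeg : (MvPolynomial.X t - MvPolynomial.C c : MvPolynomial (Fin r) k) ≠ 0 := by
    intro h
    have h1 := congrArg (MvPolynomial.eval (fun _ => c + 1)) h
    simp at h1
  have hnu : ¬ IsUnit (MvPolynomial.X t - MvPolynomial.C c : MvPolynomial (Fin r) k) := by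
    intro h
    have h1 := h.map (MvPolynomial.eval (fun _ => c))
    simp at h1
  refine anisoR_step (ρ : MvPolynomial (Fin r) k →+* MvPolynomial (Fin r) k) _ hdeg
    (by simp [hρ]) ?_ ?_ a b ha hb
  · intro x hx
    have h1 : ∀ x : MvPolynomial (Fin r) k, (MvPolynomial.X t - MvPolynomial.C c) ∣ x - ρ x := by
      intro x
      rw [← Ideal.mem_span_singleton, ← Ideal.Quotient.eq]
      have : Ideal.Quotient.mkₐ k (Ideal.span {(MvPolynomial.X t - MvPolynomial.C c : MvPolynomial (Fin r) k)})
        = (Ideal.Quotient.mkₐ k _).comp ρ := by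
        ext s
        simp only [AlgHom.comp_apply, hρ, MvPolynomial.aeval_X]
        split_ifs with hs
        · subst hs
          rw [Ideal.Quotient.mkₐ_eq_mk, Ideal.Quotient.eq, Ideal.mem_span_singleton]
        · rfl
      exact congrArg (fun g => g x) this
    have h2 := h1 x
    rw [show ρ x = 0 from hx, sub_zero] at h2
    exact h2
  · intro x hx
    by_contra hx0
    obtain ⟨n, hn⟩ := FiniteMultiplicity.of_not_isUnit hnu hx0
    exact hn (hx _)

lemma ev_rename {k : Type} [Field k] {m r : ℕ} (hm : m ≤ r) (t : Fin r) (ht : m ≤ t.val) (a : k)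
    (p : MvPolynomial (Fin m) k) :
    MvPolynomial.aeval (fun s => if s = t then MvPolynomial.C a else
          (MvPolynomial.X s : MvPolynomial (Fin r) k)) (MvPolynomial.rename (Fin.castLE hm) p) =
      MvPolynomial.rename (Fin.castLE hm) p := by
  rw [MvPolynomial.aeval_rename]
  change _ = (MvPolynomial.rename (Fin.castLE hm)) p
  apply congrArg (fun g : MvPolynomial (Fin m) k →ₐ[k] MvPolynomial (Fin r) k => g p)
  apply MvPolynomial.algHom_ext
  intro s
  have : Fin.castLE hm s ≠ t := by
    intro h
    have := congrArg Fin.val h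
    have h3 := s.2
    simp at this
    omega
  simp [this]

lemma exists_phi {k : Type} [Field k] {N : ℕ} (d : Fin N → k) (h : AnisoR d) (r : ℕ) :
    ∀ m (hm : m ≤ r), ∃ (J : Type) (_ : Fintype J) (c : J → MvPolynomial (Fin m) k),
      Fintype.card J = N * 2 ^ m ∧
      AnisoR (fun j => MvPolynomial.rename (Fin.castLE hm) (c j)) := by
  intro m
  induction m with
  | zero =>
    intro hm
    refine ⟨Fin N, inferInstance, fun j => MvPolynomial.C (d j), by simp, ?_⟩
    simpa using anisoR_mv d h r
  | succ m ih =>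
    intro hm
    obtain ⟨J, _, c, hJ, hc⟩ := ih (by omega)
    refine ⟨J ⊕ J, inferInstance, Sum.elim (fun j => MvPolynomial.rename Fin.castSucc (c j))
      (fun j => MvPolynomial.X (Fin.last m) * MvPolynomial.rename Fin.castSucc (c j)), ?_, ?_⟩
    · rw [Fintype.card_sum, hJ, pow_succ]; ring
    · have h1 : ∀ j, MvPolynomial.aeval (fun s => if s = (⟨m, by omega⟩ : Fin r) then MvPolynomial.C (0:k) else
          (MvPolynomial.X s : MvPolynomial (Fin r) k))
          (MvPolynomial.rename (Fin.castLE (by omega : m ≤ r)) (c j)) =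
          MvPolynomial.rename (Fin.castLE (by omega : m ≤ r)) (c j) := by
        intro j
        exact ev_rename _ _ (by simp) _ _
      have := anisoR_mv_step (⟨m, by omega⟩ : Fin r) 0
        (fun j => MvPolynomial.rename (Fin.castLE (by omega : m ≤ r)) (c j))
        (fun j => MvPolynomial.rename (Fin.castLE (by omega : m ≤ r)) (c j))
        (by simpa only [h1] using hc) (by simpa only [h1] using hc)
      convert this using 1
      funext j
      rcases j with j | j
      · simp [MvPolynomial.rename_rename]
      · simp [MvPolynomial.rename_rename]; left; rfl

/-- `ψ = ⟨1, -f, x, -xh⟩` -/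
def psiR {R : Type*} [CommRing R] (x y : R) : Fin 4 → R :=
  ![1, -(y ^ 4 - y ^ 3 + y), x, -(x * (1 - (y ^ 4 - y ^ 3 + y)))]

lemma aniso_full {k : Type} [Field k] (h2 : (2 : k) ≠ 0) {m : ℕ} {J : Type} [Fintype J]
    (c : J → MvPolynomial (Fin m) k)
    (hc : AnisoR (fun j => MvPolynomial.rename (Fin.castLE (by omega : m ≤ m + 2)) (c j))) :
    AnisoR (fun j : J × Fin 4 => MvPolynomial.rename (Fin.castLE (by omega : m ≤ m + 2)) (c j.1) *
      psiR (MvPolynomial.X ⟨m, by omega⟩) (MvPolynomial.X ⟨m+1, by omega⟩) j.2) := by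
  set C' := fun j => MvPolynomial.rename (Fin.castLE (by omega : m ≤ m + 2)) (c j) with hC'
  set x : MvPolynomial (Fin (m+2)) k := MvPolynomial.X ⟨m, by omega⟩ with hx
  set y : MvPolynomial (Fin (m+2)) k := MvPolynomial.X ⟨m+1, by omega⟩ with hy
  have hev1 : ∀ (a : k) j,
      MvPolynomial.aeval (fun s => if s = (⟨m+1, by omega⟩ : Fin (m+2)) then MvPolynomial.C a else
          (MvPolynomial.X s : MvPolynomial (Fin (m+2)) k)) (C' j) = C' j :=
    fun a j => ev_rename _ _ (by simp) _ _
  have hev0 : ∀ (a : k) j,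
      MvPolynomial.aeval (fun s => if s = (⟨m, by omega⟩ : Fin (m+2)) then MvPolynomial.C a else
          (MvPolynomial.X s : MvPolynomial (Fin (m+2)) k)) (C' j) = C' j :=
    fun a j => ev_rename _ _ (by simp) _ _
  -- first: f-part
  have hf : AnisoR (Sum.elim C' (fun j => C' j * (-(y ^ 4 - y ^ 3 + y)))) := by
    have := anisoR_mv_step (⟨m+1, by omega⟩ : Fin (m+2)) (0:k) C' (fun j => C' j * (-(y^3 - y^2 + 1)))
      (by simpa only [hev1] using hc)
      (by
        simp only [map_mul, hev1]
        have := anisoR_smul _ (-1) (by simp) hc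
        convert this using 2 with j
        simp [hy])
    convert this using 2
    funext j
    rw [← hy]; simp only [map_zero]; ring
  have hh : AnisoR (Sum.elim C' (fun j => C' j * (-(1 - (y ^ 4 - y ^ 3 + y))))) := by
    have := anisoR_mv_step (⟨m+1, by omega⟩ : Fin (m+2)) (1:k) C' (fun j => C' j * (1 + y^3))
      (by simpa only [hev1] using hc)
      (by
        simp only [map_mul, hev1]
        have := anisoR_smul _ (MvPolynomial.C 2) (by simpa using h2) hc
        convert this using 2 with j
        rw [mul_comm]
        congr 1
        simp [hy]
        rw [one_add_one_eq_two]; rfl)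
    convert this using 2
    funext j
    rw [← hy]; simp only [map_one]; ring
  have hne : (⟨m+1, by omega⟩ : Fin (m+2)) ≠ ⟨m, by omega⟩ := by simp
  have hyev : MvPolynomial.aeval (fun s => if s = (⟨m, by omega⟩ : Fin (m+2)) then MvPolynomial.C 0 else
          (MvPolynomial.X s : MvPolynomial (Fin (m+2)) k)) y = y := by
    simp [hy]
  have hfull := anisoR_mv_step (⟨m, by omega⟩ : Fin (m+2)) (0:k)
    (Sum.elim C' (fun j => C' j * (-(y ^ 4 - y ^ 3 + y))))
    (Sum.elim C' (fun j => C' j * (-(1 - (y ^ 4 - y ^ 3 + y)))))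
    (by
      convert hf using 2 with j
      rcases j with j | j
      · exact hev0 _ _
      · simp only [Sum.elim_inr, map_mul, hev0, map_neg, map_sub, map_add, map_pow, hyev])
    (by
      convert hh using 2 with j
      rcases j with j | j
      · exact hev0 _ _
      · simp only [Sum.elim_inr, map_mul, hev0, map_neg, map_sub, map_add, map_pow, hyev, map_one])
  refine anisoR_reindex _ _ (fun j : J × Fin 4 =>
    (![Sum.inl (Sum.inl j.1), Sum.inl (Sum.inr j.1), Sum.inr (Sum.inl j.1), Sum.inr (Sum.inr j.1)] j.2 :
      (J ⊕ J) ⊕ (J ⊕ J))) ?_ ?_ hfull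
  · rintro ⟨a, s⟩ ⟨b, t⟩ h
    fin_cases s <;> fin_cases t <;> simp_all
  · rintro ⟨a, s⟩
    change C' a * _ = _
    fin_cases s
    · simp [psiR]
    · simp [psiR]
    · simp [psiR, ← hx]; ring
    · simp [psiR, ← hx]; ring

open Polynomial in
lemma exists_odd_factor {K : Type} [Field K] : ∀ (n : ℕ) (g : K[X]), g.natDegree = n → Odd n →
    ∃ p, Irreducible p ∧ Odd p.natDegree ∧ p ∣ g := by
  intro n
  induction n using Nat.strong_induction_on with
  | _ n ih =>
    intro g hg hn
    have hg0 : g ≠ 0 := by rintro rfl; simp at hg; subst hg; simp at hn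
    obtain ⟨q, hq, g', rfl⟩ := Polynomial.exists_irreducible_of_natDegree_ne_zero
      (f := g) (by rw [hg]; rintro rfl; simp at hn)
    by_cases ho : Odd q.natDegree
    · exact ⟨q, hq, ho, dvd_mul_right _ _⟩
    · have hg' : g' ≠ 0 := right_ne_zero_of_mul hg0
      rw [natDegree_mul hq.ne_zero hg'] at hg
      have hpos := hq.natDegree_pos
      have hodd : Odd g'.natDegree := by
        rw [← hg] at hn
        rw [Nat.not_odd_iff_even] at ho
        exact (Nat.odd_add'.1 hn).2 ho
      obtain ⟨p, h1, h2, h3⟩ := ih g'.natDegree (by omega) g' rfl hodd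
      exact ⟨p, h1, h2, h3.mul_left _⟩

open Polynomial in
lemma natDegree_form {K : Type} [Field K] {ι : Type} [Fintype ι] (d : ι → K) (hd : AnisoR d)
    (w : ι → K[X]) (hw : w ≠ 0) :
    (∑ j, C (d j) * w j ^ 2) ≠ 0 ∧
    (∑ j, C (d j) * w j ^ 2).natDegree = 2 * Finset.univ.sup (fun j => (w j).natDegree) := by
  set M := Finset.univ.sup (fun j => (w j).natDegree) with hM
  have hle : ∀ j, (w j).natDegree ≤ M := fun j => Finset.le_sup (f := fun j => (w j).natDegree) (Finset.mem_univ j)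
  have hc : (∑ j, C (d j) * w j ^ 2).coeff (2 * M) ≠ 0 := by
    rw [finsetSum_coeff]
    have h1 : ∀ j, (C (d j) * w j ^ 2).coeff (2 * M) = d j * ((w j).coeff M) ^ 2 := by
      intro j
      rw [coeff_C_mul, coeff_pow_of_natDegree_le (hle j)]
    simp only [h1]
    intro h
    have h2 := hd _ h
    by_cases hM0 : M = 0
    · apply hw
      funext j
      have h3 := congrFun h2 j
      simp only [hM0] at h3
      have h4 := hle j
      rw [hM0] at h4
      rw [eq_C_of_natDegree_le_zero h4, h3]; simp
    · have hne : (Finset.univ : Finset ι).Nonempty := by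
        by_contra h
        rw [Finset.not_nonempty_iff_eq_empty] at h
        rw [h] at hM; simp at hM; exact hM0 hM
      obtain ⟨j, _, hj⟩ := Finset.exists_mem_eq_sup _ hne (fun j => (w j).natDegree)
      have h3 := congrFun h2 j
      simp only [Pi.zero_apply] at h3
      rw [hM, hj] at h3
      rw [← leadingCoeff, leadingCoeff_eq_zero] at h3
      rw [← hM, h3] at hj
      simp at hj; exact hM0 hj
  refine ⟨fun h => hc (by rw [h]; simp), le_antisymm ?_ (le_natDegree_of_ne_zero hc)⟩
  apply natDegree_sum_le_of_forall_le
  intro j _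
  refine (natDegree_C_mul_le _ _).trans ?_
  refine natDegree_pow_le.trans ?_
  exact Nat.mul_le_mul_left _ (hle j)

open Polynomial in
lemma springer_poly {K : Type} [Field K] {ι : Type} [Fintype ι] (d : ι → K) (hd : AnisoR d) :
    ∀ (n : ℕ) (p : K[X]), Irreducible p → p.natDegree = n → Odd n → ∀ w : ι → K[X],
      p ∣ ∑ j, C (d j) * w j ^ 2 → ∀ j, p ∣ w j := by
  intro n
  induction n using Nat.strong_induction_on with
  | _ n ih =>
    intro p hp hpn hn
    have inner : ∀ (N : ℕ) (w : ι → K[X]), ∑ j, (w j).natDegree = N →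
        (∀ j, (w j).natDegree < n) → p ∣ ∑ j, C (d j) * w j ^ 2 → w = 0 := by
      intro N
      induction N using Nat.strong_induction_on with
      | _ N ihN =>
        intro w hwN hwn hdvd
        by_contra hw
        obtain ⟨hS, hdeg⟩ := natDegree_form d hd w hw
        have hsup : Finset.univ.sup (fun j => (w j).natDegree) < n :=
          (Finset.sup_lt_iff (by simpa using hn.pos)).2 (fun j _ => hwn j)
        obtain ⟨g, hg⟩ := hdvd
        have hg0 : g ≠ 0 := by rintro rfl; rw [mul_zero] at hg; exact hS hg
        rw [hg, natDegree_mul hp.ne_zero hg0, hpn] at hdeg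
        have hgodd : Odd g.natDegree := by
          have : Even (n + g.natDegree) := by rw [hdeg]; simp
          rcases hn with ⟨a, ha⟩
          rcases this with ⟨b, hb⟩
          exact ⟨b - a - 1, by omega⟩
        obtain ⟨p', hp', hodd', hdvd'⟩ := exists_odd_factor _ g rfl hgodd
        have hlt : p'.natDegree < n := lt_of_le_of_lt (natDegree_le_of_dvd hdvd' hg0) (by omega)
        have hall := ih _ hlt p' hp' rfl hodd' w (by rw [hg]; exact hdvd'.mul_left _)
        choose w' hw' using hall
        have hS' : ∑ j, C (d j) * w j ^ 2 = p' ^ 2 * ∑ j, C (d j) * w' j ^ 2 := by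
          rw [Finset.mul_sum]
          refine Finset.sum_congr rfl fun j _ => ?_
          rw [hw' j]; ring
        have hpp : ¬ p ∣ p' := by
          intro h
          have := natDegree_le_of_dvd h hp'.ne_zero
          omega
        have hdvd2 : p ∣ ∑ j, C (d j) * w' j ^ 2 := by
          have : p ∣ p' ^ 2 * ∑ j, C (d j) * w' j ^ 2 := by rw [← hS', hg]; exact dvd_mul_right _ _
          rcases hp.prime.dvd_or_dvd this with h | h
          · exact absurd (hp.prime.dvd_of_dvd_pow h) hpp
          · exact h
        have hle : ∀ j, (w' j).natDegree ≤ (w j).natDegree := by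
          intro j
          by_cases h0 : w' j = 0
          · rw [h0]; simp
          · rw [hw' j, natDegree_mul hp'.ne_zero h0]; omega
        obtain ⟨j0, hj0⟩ := Function.ne_iff.1 hw
        have hltS : ∑ j, (w' j).natDegree < N := by
          rw [← hwN]
          apply Finset.sum_lt_sum (fun j _ => hle j)
          refine ⟨j0, Finset.mem_univ _, ?_⟩
          have h0 : w' j0 ≠ 0 := by
            intro h; apply hj0; rw [hw' j0, h]; simp
          have := hp'.natDegree_pos
          rw [hw' j0, natDegree_mul hp'.ne_zero h0]; omega
        have := ihN _ hltS w' rfl (fun j => (hle j).trans_lt (hwn j)) hdvd2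
        apply hw
        funext j
        rw [hw' j, this]; simp
    intro w hw
    have h1 := inner _ (fun j => w j % p) rfl (fun j => by
      rw [← hpn]; exact natDegree_mod_lt _ (by rw [hpn]; rintro rfl; simp at hn)) (by
      have h2 : p ∣ ∑ j, (C (d j) * w j ^ 2 - C (d j) * (w j % p) ^ 2) := by
        apply Finset.dvd_sum
        intro j _
        rw [← mul_sub, sq_sub_sq]
        apply Dvd.dvd.mul_left
        apply Dvd.dvd.mul_left
        exact ⟨w j / p, by rw [eq_comm, ← sub_eq_zero]; linear_combination EuclideanDomain.div_add_mod (w j) p⟩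
      rw [Finset.sum_sub_distrib] at h2
      exact (dvd_sub_right hw).1 h2)
    intro j
    exact EuclideanDomain.mod_eq_zero.1 (congrFun h1 j)

lemma springer : ∀ (n : ℕ) (K L : Type) [Field K] [Field L] [Algebra K L] [FiniteDimensional K L]
    (_ : Module.finrank K L = n) (_ : Odd n) {ι : Type} [Fintype ι] (d : ι → K) (_ : AnisoR d),
    AnisoR (fun j => algebraMap K L (d j)) := by
  intro n
  induction n using Nat.strong_induction_on with
  | _ n ih =>
    intro K L _ _ _ _ hn hodd ι _ d hd
    by_cases hsurj : ∀ x : L, x ∈ (⊥ : IntermediateField K L)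
    · intro w hw
      have h1 : ∀ j, ∃ z, algebraMap K L z = w j := fun j => by
        simpa [IntermediateField.mem_bot] using hsurj (w j)
      choose z hz using h1
      have := hd z (by
        apply (algebraMap K L).injective
        rw [map_zero, ← hw, map_sum]
        refine Finset.sum_congr rfl fun j _ => ?_
        rw [← hz j]; simp)
      funext j
      rw [← hz j, this]; simp
    · push Not at hsurj
      obtain ⟨θ, hθ⟩ := hsurj
      have hint : IsIntegral K θ := IsIntegral.of_finite K θ
      have htower := Module.finrank_mul_finrank K (IntermediateField.adjoin K {θ}) L
      rw [hn] at htower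
      have hodd2 : Odd (Module.finrank K (IntermediateField.adjoin K {θ})) ∧
          Odd (Module.finrank (IntermediateField.adjoin K {θ}) L) := by
        rw [← htower] at hodd
        exact Nat.odd_mul.1 hodd
      have hne1 : Module.finrank K (IntermediateField.adjoin K {θ}) ≠ 1 := by
        intro h
        rw [IntermediateField.finrank_adjoin_simple_eq_one_iff] at h
        exact hθ h
      have hF : AnisoR (fun j => algebraMap K (IntermediateField.adjoin K {θ}) (d j)) := by
        intro w hw
        have h1 : ∀ j, ∃ P : Polynomial K, w j = Polynomial.aeval (IntermediateField.AdjoinSimple.gen K θ) P := by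
          intro j
          obtain ⟨P, hP⟩ := (IntermediateField.adjoin.powerBasis hint).exists_eq_aeval' (w j)
          exact ⟨P, by rw [hP, IntermediateField.adjoin.powerBasis_gen]⟩
        choose P hP using h1
        have h2 : minpoly K (IntermediateField.AdjoinSimple.gen K θ) ∣
            ∑ j, Polynomial.C (d j) * P j ^ 2 := by
          rw [minpoly.dvd_iff, ← hw]
          simp [hP]
        have hi2 : IsIntegral K (IntermediateField.AdjoinSimple.gen K θ) := IsIntegral.of_finite K _
        have h3 := springer_poly d hd _ _ (minpoly.irreducible hi2) rfl (by
          rw [IntermediateField.minpoly_gen, ← IntermediateField.adjoin.finrank hint]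
          exact hodd2.1) P h2
        funext j
        rw [hP j]
        exact (minpoly.dvd_iff).1 (h3 j)
      have hlt : Module.finrank (IntermediateField.adjoin K {θ}) L < n := by
        have h1 := hodd2.1.pos
        have h2 := hodd2.2.pos
        rw [← htower]
        exact lt_mul_of_one_lt_left h2 (by omega)
      exact ih _ hlt (IntermediateField.adjoin K {θ}) L rfl hodd2.2 _ hF

lemma anisoR_frac {R : Type} [CommRing R] [IsDomain R] {ι : Type} [Fintype ι] (d : ι → R)
    (hd : AnisoR d) : AnisoR (fun j => algebraMap R (FractionRing R) (d j)) := by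
  intro w hw
  obtain ⟨b, hb⟩ := IsLocalization.exist_integer_multiples_of_finite (nonZeroDivisors R) w
  choose z hz using hb
  have hb0 : algebraMap R (FractionRing R) b ≠ 0 := by
    simp
  have hz' : ∀ j, algebraMap R (FractionRing R) (z j) = algebraMap R (FractionRing R) b * w j := by
    intro j; rw [hz j, Algebra.smul_def]
  have := hd z (by
    apply IsFractionRing.injective R (FractionRing R)
    rw [map_zero, map_sum]
    have : ∀ j, algebraMap R (FractionRing R) (d j * z j ^ 2) =
      (algebraMap R (FractionRing R) b)^2 * (algebraMap R (FractionRing R) (d j) * w j ^ 2) := by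
      intro j; rw [map_mul, map_pow, hz']; ring
    simp only [this]
    rw [← Finset.mul_sum, hw, mul_zero])
  funext j
  have h := hz' j
  rw [this] at h
  simp only [Pi.zero_apply, map_zero] at h
  exact (mul_eq_zero.1 h.symm).resolve_left hb0

section
attribute [local instance] FractionRing.liftAlgebra MvPolynomial.algebraMvPolynomial

lemma springer_mv {k E : Type} [Field k] [Field E] [Algebra k E] [FiniteDimensional k E]
    (hodd : Odd (Module.finrank k E)) {r : ℕ} {ι : Type} [Fintype ι]
    (d : ι → MvPolynomial (Fin r) k) (hd : AnisoR d) :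
    AnisoR (fun j => MvPolynomial.map (algebraMap k E) (d j)) := by
  have h1 := anisoR_frac d hd
  have hrank : Module.rank (FractionRing (MvPolynomial (Fin r) k)) (FractionRing (MvPolynomial (Fin r) E))
      = Module.rank k E := by
    simpa using Algebra.IsAlgebraic.rank_fractionRing_mvPolynomial (R := k) (S := E) (Fin r)
  have hfin : FiniteDimensional (FractionRing (MvPolynomial (Fin r) k)) (FractionRing (MvPolynomial (Fin r) E)) := by
    rw [FiniteDimensional, ← Module.rank_lt_aleph0_iff, hrank, Module.rank_lt_aleph0_iff]
    infer_instance
  have hfr : Module.finrank (FractionRing (MvPolynomial (Fin r) k)) (FractionRing (MvPolynomial (Fin r) E))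
      = Module.finrank k E := by rw [Module.finrank, hrank, Module.finrank]
  have h2 := springer _ _ (FractionRing (MvPolynomial (Fin r) E)) hfr hodd _ h1
  refine anisoR_comap (algebraMap _ (FractionRing (MvPolynomial (Fin r) E)))
    (IsFractionRing.injective _ _) _ ?_
  intro w hw
  apply h2 w
  rw [← hw]
  refine Finset.sum_congr rfl fun j _ => ?_
  have h3 : algebraMap (FractionRing (MvPolynomial (Fin r) k)) (FractionRing (MvPolynomial (Fin r) E))
      (algebraMap (MvPolynomial (Fin r) k) (FractionRing (MvPolynomial (Fin r) k)) (d j)) =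
      algebraMap (MvPolynomial (Fin r) E) (FractionRing (MvPolynomial (Fin r) E))
          ((MvPolynomial.map (algebraMap k E)) (d j)) := by
    rw [← IsScalarTower.algebraMap_apply (MvPolynomial (Fin r) k), IsScalarTower.algebraMap_apply (MvPolynomial (Fin r) k) (MvPolynomial (Fin r) E)]
    rfl
  beta_reduce
  rw [h3]
end

lemma count_exists (i r : ℕ) : ∃ C : ℕ, 1 ≤ C ∧ (2 * C + 1) ^ r * 2 ^ i < (2 ^ (i + r) + 1) * C ^ r := by
  have h1 : Filter.Tendsto (fun C : ℕ => (2 + 1 / (C : ℝ)) ^ r * 2 ^ i) Filter.atTop (nhds ((2 + 0) ^ r * 2 ^ i)) :=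
    ((tendsto_const_nhds.add tendsto_one_div_atTop_nhds_zero_nat).pow r).mul_const _
  have h2 : ((2 + 0 : ℝ) ^ r * 2 ^ i) < 2 ^ (i + r) + 1 := by
    rw [add_zero, pow_add, mul_comm]; linarith
  obtain ⟨C, hC, hC1⟩ := ((h1.eventually (gt_mem_nhds h2)).and (Filter.eventually_ge_atTop 1)).exists
  refine ⟨C, hC1, ?_⟩
  have hpos : (0 : ℝ) < C := by exact_mod_cast hC1
  have h3 : ((2 * C + 1 : ℝ)) ^ r * 2 ^ i < (2 ^ (i + r) + 1) * C ^ r := by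
    have : (2 * C + 1 : ℝ) = (2 + 1 / C) * C := by field_simp
    rw [this, mul_pow]
    have h4 : (0:ℝ) < C ^ r := by positivity
    nlinarith [mul_lt_mul_of_pos_right hC h4]
  exact_mod_cast h3

/-- exponent vector -/
noncomputable def monF {r B : ℕ} (α : Fin r → Fin B) : Fin r →₀ ℕ :=
  Finsupp.equivFunOnFinite.symm (fun k => (α k : ℕ))

lemma monF_inj {r B : ℕ} : Function.Injective (monF : (Fin r → Fin B) → _) := by
  intro a b h
  funext k
  have := DFunLike.congr_fun h k
  simp [monF] at this
  exact Fin.ext this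

lemma u_bound_poly (ℓ : Type) [Field ℓ] (i : ℕ) (hA : propertyA ℓ i) (r : ℕ) {ι : Type} [Fintype ι]
    (hι : 2 ^ (i + r) < Fintype.card ι) (d : ι → MvPolynomial (Fin r) ℓ) : ¬ AnisoR d := by
  classical
  intro hd
  obtain ⟨C, hC1, hC⟩ := count_exists i r
  set e := 1 + ∑ j, (d j).totalDegree with he
  have hde : ∀ j, (d j).totalDegree < e := by
    intro j
    have := Finset.single_le_sum (f := fun j => (d j).totalDegree) (fun _ _ => Nat.zero_le _) (Finset.mem_univ j)
    beta_reduce at this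
    omega
  set B := C * e with hB
  set D := (2 * C + 1) * e with hD
  let U := ι × (Fin r → Fin B)
  let G := Fin r → Fin D
  have hcard : Fintype.card G * 2 ^ i < Fintype.card U := by
    simp only [G, U, Fintype.card_prod, Fintype.card_fun, Fintype.card_fin]
    rw [hD, hB, mul_pow, mul_pow]
    have he0 : 0 < e ^ r := pow_pos (by omega) r
    calc (2 * C + 1) ^ r * e ^ r * 2 ^ i = ((2 * C + 1) ^ r * 2 ^ i) * e ^ r := by ring
      _ < ((2 ^ (i + r) + 1) * C ^ r) * e ^ r := Nat.mul_lt_mul_of_pos_right hC he0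
      _ ≤ (Fintype.card ι * C ^ r) * e ^ r := by gcongr; omega
      _ = _ := by ring
  let P' : G → MvPolynomial U ℓ := fun γ => ∑ j, ∑ α : Fin r → Fin B, ∑ β : Fin r → Fin B,
    MvPolynomial.C (MvPolynomial.coeff (monF γ) (d j * MvPolynomial.monomial (monF α + monF β) 1)) *
      (MvPolynomial.X (j, α) * MvPolynomial.X (j, β))
  have hP' : ∀ γ, (P' γ).IsHomogeneous 2 := by
    intro γ
    refine MvPolynomial.IsHomogeneous.sum _ _ _ fun j _ => MvPolynomial.IsHomogeneous.sum _ _ _ fun α _ =>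
      MvPolynomial.IsHomogeneous.sum _ _ _ fun β _ => ?_
    exact (MvPolynomial.isHomogeneous_C _ _).mul
      ((MvPolynomial.isHomogeneous_X _ _).mul (MvPolynomial.isHomogeneous_X _ _))
  obtain ⟨E, _, _, _, hodd, x, hx0, hx⟩ := hA (Fintype.card G) (Fintype.card U)
    (fun t => MvPolynomial.rename (Fintype.equivFin U) (P' ((Fintype.equivFin G).symm t)))
    (fun t => (hP' _).rename_isHomogeneous) hcard
  set t : U → E := fun u => x (Fintype.equivFin U u) with ht
  have hx' : ∀ γ : Fin r → Fin D, ∑ j, ∑ α : Fin r → Fin B, ∑ β : Fin r → Fin B,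
      algebraMap ℓ E (MvPolynomial.coeff (monF γ) (d j * MvPolynomial.monomial (monF α + monF β) 1)) *
      (t (j, α) * t (j, β)) = 0 := by
    intro γ
    have := hx (Fintype.equivFin G γ)
    simp only [MvPolynomial.aeval_rename, Equiv.symm_apply_apply, P', map_sum, map_mul, MvPolynomial.aeval_X,
      MvPolynomial.algHom_C, AlgHom.commutes] at this
    exact this
  let w : ι → MvPolynomial (Fin r) E := fun j => ∑ α : Fin r → Fin B, MvPolynomial.monomial (monF α) (t (j, α))
  have hsum : ∑ j, MvPolynomial.map (algebraMap ℓ E) (d j) * w j ^ 2 = 0 := by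
    have hexp : ∀ j, MvPolynomial.map (algebraMap ℓ E) (d j) * w j ^ 2 =
        ∑ α : Fin r → Fin B, ∑ β : Fin r → Fin B, MvPolynomial.map (algebraMap ℓ E) (d j) *
          MvPolynomial.monomial (monF α + monF β) (t (j, α) * t (j, β)) := by
      intro j
      simp only [w]
      rw [sq, Finset.sum_mul_sum, Finset.mul_sum]
      refine Finset.sum_congr rfl fun α _ => ?_
      rw [Finset.mul_sum]
      refine Finset.sum_congr rfl fun β _ => ?_
      rw [MvPolynomial.monomial_mul]
    ext γ
    simp only [hexp, MvPolynomial.coeff_sum, MvPolynomial.coeff_zero]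
    by_cases hγ : ∀ k, γ k < D
    · have hγ' : γ = monF (fun k => (⟨γ k, hγ k⟩ : Fin D)) := by
        ext k; simp [monF]
      rw [← hx' (fun k => (⟨γ k, hγ k⟩ : Fin D)), ← hγ']
      refine Finset.sum_congr rfl fun j _ => Finset.sum_congr rfl fun α _ => Finset.sum_congr rfl fun β _ => ?_
      rw [MvPolynomial.coeff_mul_monomial', MvPolynomial.coeff_mul_monomial']
      split_ifs
      · rw [MvPolynomial.coeff_map, mul_one]
      · simp
    · push Not at hγ
      obtain ⟨k, hk⟩ := hγ
      refine Finset.sum_eq_zero fun j _ => Finset.sum_eq_zero fun α _ => Finset.sum_eq_zero fun β _ => ?_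
      rw [MvPolynomial.coeff_mul_monomial']
      split_ifs
      · rw [MvPolynomial.coeff_map]
        have : MvPolynomial.coeff (γ - (monF α + monF β)) (d j) = 0 := by
          by_contra h
          have h1 := MvPolynomial.monomial_le_degreeOf k (MvPolynomial.mem_support_iff.2 h)
          have h2 := MvPolynomial.degreeOf_le_totalDegree (d j) k
          have h3 := hde j
          have h4 : (γ - (monF α + monF β)) k = γ k - ((α k : ℕ) + (β k : ℕ)) := by
            simp [monF]
          rw [h4] at h1
          have h5 := (α k).2
          have h6 := (β k).2
          have h7 : D = 2 * B + e := by rw [hD, hB]; ring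
          omega
        rw [this]; simp
      · rfl
  have hw := springer_mv hodd d hd w hsum
  apply hx0
  funext s
  have h1 := congrArg (MvPolynomial.coeff (monF ((Fintype.equivFin U).symm s).2))
    (congrFun hw ((Fintype.equivFin U).symm s).1)
  simp only [w, MvPolynomial.coeff_sum, MvPolynomial.coeff_monomial, monF_inj.eq_iff, Pi.zero_apply,
    MvPolynomial.coeff_zero, Finset.sum_ite_eq', Finset.mem_univ, if_true, ht] at h1
  simpa using h1

lemma u_bound (ℓ : Type) [Field ℓ] (i : ℕ) (hA : propertyA ℓ i) (r : ℕ) {ι : Type} [Fintype ι]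
    (hι : 2 ^ (i + r) < Fintype.card ι) (d : ι → Lfield ℓ r) : ¬ AnisoR d := by
  intro hd
  have h1 : ∀ j, ∃ a b : MvPolynomial (Fin r) ℓ, b ≠ 0 ∧ algebraMap _ (Lfield ℓ r) a = algebraMap _ (Lfield ℓ r) b * d j := by
    intro j
    obtain ⟨a, b, hb, h⟩ := IsFractionRing.div_surjective (A := MvPolynomial (Fin r) ℓ) (d j)
    have hb0 := nonZeroDivisors.ne_zero hb
    have : algebraMap _ (Lfield ℓ r) b ≠ 0 := by simpa using hb0
    exact ⟨a, b, hb0, by rw [← h]; field_simp⟩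
  choose a b hb hab using h1
  apply u_bound_poly ℓ i hA r hι (fun j => a j * b j)
  intro w hw
  have := hd (fun j => algebraMap _ (Lfield ℓ r) (b j * w j)) (by
    have := congrArg (algebraMap _ (Lfield ℓ r)) hw
    rw [map_zero, map_sum] at this
    rw [← this]
    refine Finset.sum_congr rfl fun j _ => ?_
    simp only [map_mul, map_pow, hab]; ring)
  funext j
  have h2 := congrFun this j
  simp only [Pi.zero_apply] at h2
  have h3 : b j * w j = 0 := by
    apply IsFractionRing.injective (MvPolynomial (Fin r) ℓ) (Lfield ℓ r)
    rw [h2, map_zero]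
  exact (mul_eq_zero.1 h3).resolve_left (hb j)

lemma diagQF_app (k : Type) [Field k] {ι : Type} [Fintype ι] (d w : ι → k) :
    diagQF k d w = ∑ j, d j * w j ^ 2 := by
  simp [diagQF, QuadraticMap.weightedSumSquares_apply, sq]

lemma formIsom_of {k : Type} [Field k] {ι κ : Type} [Fintype ι] [Fintype κ] {d : ι → k} {e : κ → k}
    (T : (ι → k) ≃ₗ[k] (κ → k)) (h : ∀ w, ∑ j, e j * (T w j) ^ 2 = ∑ j, d j * w j ^ 2) : FormIsom k d e :=
  ⟨⟨T, fun w => by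
    show diagQF k e (T w) = diagQF k d w
    rw [diagQF_app, diagQF_app, h]⟩⟩

lemma formIsom_refl {k : Type} [Field k] {ι : Type} [Fintype ι] (d : ι → k) : FormIsom k d d :=
  QuadraticMap.Equivalent.refl _

lemma FormIsom.tr {k : Type} [Field k] {ι κ μ : Type} [Fintype ι] [Fintype κ] [Fintype μ]
    {d : ι → k} {e : κ → k} {f : μ → k} (h : FormIsom k d e) (h' : FormIsom k e f) : FormIsom k d f :=
  QuadraticMap.Equivalent.trans h h'

lemma FormIsom.sy {k : Type} [Field k] {ι κ : Type} [Fintype ι] [Fintype κ]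
    {d : ι → k} {e : κ → k} (h : FormIsom k d e) : FormIsom k e d :=
  QuadraticMap.Equivalent.symm h

lemma formIsom_iff {k : Type} [Field k] {ι κ : Type} [Fintype ι] [Fintype κ] {d : ι → k} {e : κ → k}
    (h : FormIsom k d e) : ∃ T : (ι → k) ≃ₗ[k] (κ → k), ∀ w, ∑ j, e j * (T w j) ^ 2 = ∑ j, d j * w j ^ 2 := by
  obtain ⟨T⟩ := h
  refine ⟨T.toLinearEquiv, fun w => ?_⟩
  rw [← diagQF_app, ← diagQF_app]
  exact T.map_app w

lemma formIsom_reindex {k : Type} [Field k] {ι κ : Type} [Fintype ι] [Fintype κ] (d : ι → k) (e : κ → k)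
    (σ : ι ≃ κ) (h : ∀ j, d j = e (σ j)) : FormIsom k d e := by
  refine formIsom_of (LinearEquiv.funCongrLeft k k σ.symm) fun w => ?_
  symm
  refine Fintype.sum_equiv σ _ _ fun j => ?_
  simp [h, LinearEquiv.funCongrLeft_apply, LinearMap.funLeft_apply]

lemma formIsom_sum {k : Type} [Field k] {ι κ ι' κ' : Type} [Fintype ι] [Fintype κ] [Fintype ι'] [Fintype κ']
    {d : ι → k} {e : κ → k} {d' : ι' → k} {e' : κ' → k} (h : FormIsom k d e) (h' : FormIsom k d' e') :
    FormIsom k (Sum.elim d d') (Sum.elim e e') := by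
  obtain ⟨T, hT⟩ := formIsom_iff h
  obtain ⟨T', hT'⟩ := formIsom_iff h'
  refine formIsom_of ((LinearEquiv.sumArrowLequivProdArrow ι ι' k k).trans
    ((T.prodCongr T').trans (LinearEquiv.sumArrowLequivProdArrow κ κ' k k).symm)) fun w => ?_
  simp only [Fintype.sum_sum_type, Sum.elim_inl, Sum.elim_inr]
  rw [← hT (fun j => w (Sum.inl j)), ← hT' (fun j => w (Sum.inr j))]
  rfl

lemma formIsom_fam {k : Type} [Field k] {α ι κ : Type} [Fintype α] [Fintype ι] [Fintype κ]
    {d : α × ι → k} {e : α × κ → k} (h : ∀ a, FormIsom k (fun j => d (a, j)) (fun j => e (a, j))) :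
    FormIsom k d e := by
  choose T hT using fun a => formIsom_iff (h a)
  refine formIsom_of ((LinearEquiv.curry k k α ι).trans
    ((LinearEquiv.piCongrRight T).trans (LinearEquiv.curry k k α κ).symm)) fun w => ?_
  simp only [Fintype.sum_prod_type]
  refine Finset.sum_congr rfl fun a _ => ?_
  rw [← hT a (fun j => w (a, j))]
  rfl

lemma formIsom_scale {k : Type} [Field k] {ι : Type} [Fintype ι] {d e s : ι → k} (hs : ∀ j, s j ≠ 0)
    (h : ∀ j, d j = e j * s j ^ 2) : FormIsom k d e := by
  refine formIsom_of (LinearEquiv.piCongrRight fun j => LinearEquiv.smulOfNeZero k k (s j) (hs j)) fun w => ?_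
  refine Finset.sum_congr rfl fun j _ => ?_
  simp only [LinearEquiv.piCongrRight_apply, LinearEquiv.smulOfNeZero_apply, smul_eq_mul, h]
  ring

/-- a 2x2 change of variables -/
noncomputable def lin2 {k : Type} [Field k] (a b c d : k) (h : a * d - b * c ≠ 0) :
    (Fin 2 → k) ≃ₗ[k] (Fin 2 → k) where
  toFun w := ![a * w 0 + b * w 1, c * w 0 + d * w 1]
  map_add' x y := by ext j; fin_cases j <;> simp <;> ring
  map_smul' r x := by ext j; fin_cases j <;> simp <;> ring
  invFun w := ![(d * w 0 - b * w 1) / (a * d - b * c), (a * w 1 - c * w 0) / (a * d - b * c)]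
  left_inv w := by
    ext j
    fin_cases j
    · simp only [Fin.zero_eta, Matrix.cons_val_zero, Matrix.cons_val_one]
      rw [div_eq_iff h]; ring
    · simp only [Fin.mk_one, Matrix.cons_val_zero, Matrix.cons_val_one]
      rw [div_eq_iff h]; ring
  right_inv w := by
    ext j
    fin_cases j
    · simp only [Fin.zero_eta, Matrix.cons_val_zero, Matrix.cons_val_one]
      rw [← mul_div_assoc, ← mul_div_assoc, ← add_div, div_eq_iff h]; ring
    · simp only [Fin.mk_one, Matrix.cons_val_zero, Matrix.cons_val_one]
      rw [← mul_div_assoc, ← mul_div_assoc, ← add_div, div_eq_iff h]; ring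

lemma formIsom_bin {k : Type} [Field k] (a b : k) (h : a + b ≠ 0) :
    FormIsom k ![a, b] ![a + b, a * b * (a + b)] := by
  have h1 : a / (a + b) * (-1 / (a + b)) - b / (a + b) * (1 / (a + b)) ≠ 0 := by
    have : a / (a + b) * (-1 / (a + b)) - b / (a + b) * (1 / (a + b)) = - (1 / (a + b)) := by
      field_simp; ring
    rw [this]; exact neg_ne_zero.2 (one_div_ne_zero h)
  refine formIsom_of (lin2 _ _ _ _ h1) fun w => ?_
  simp [lin2, Fin.sum_univ_two]
  field_simp
  ring

lemma formIsom_hyp {k : Type} [Field k] (h2 : (2 : k) ≠ 0) (s : k) (hs : s ≠ 0) :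
    FormIsom k ![s, -s] ![1, -1] := by
  have h1 : (s + 1) / 2 * ((s + 1) / 2) - (s - 1) / 2 * ((s - 1) / 2) ≠ 0 := by
    have : (s + 1) / 2 * ((s + 1) / 2) - (s - 1) / 2 * ((s - 1) / 2) = s := by field_simp; ring
    rwa [this]
  refine formIsom_of (lin2 _ _ _ _ h1) fun w => ?_
  simp [lin2, Fin.sum_univ_two]
  field_simp
  ring

/-- splits off at least `m` hyperbolic planes -/
def SplitsH (k : Type) [Field k] {ι : Type} [Fintype ι] (m : ℕ) (d : ι → k) : Prop :=
  ∃ (s : ℕ) (e : Fin s → k), FormIsom k d (Sum.elim (hypForm k m) e)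

lemma formIsom_card {k : Type} [Field k] {ι κ : Type} [Fintype ι] [Fintype κ] {d : ι → k} {e : κ → k}
    (h : FormIsom k d e) : Fintype.card ι = Fintype.card κ := by
  obtain ⟨T, _⟩ := formIsom_iff h
  simpa using T.finrank_eq

lemma splitsH_le {k : Type} [Field k] {ι : Type} [Fintype ι] {m : ℕ} {d : ι → k} (h : SplitsH k m d) :
    m ≤ wittIndex k d := by
  refine le_csSup ⟨Fintype.card ι, ?_⟩ h
  rintro m ⟨s, e, h⟩
  have := formIsom_card h
  simp at this
  omega

lemma splitsH_congr {k : Type} [Field k] {ι κ : Type} [Fintype ι] [Fintype κ] {m : ℕ} {d : ι → k} {e : κ → k}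
    (h : FormIsom k d e) (he : SplitsH k m e) : SplitsH k m d := by
  obtain ⟨s, f, hf⟩ := he
  exact ⟨s, f, h.tr hf⟩

lemma splitsH_of {k : Type} [Field k] {ι κ : Type} [Fintype ι] [Fintype κ] {m : ℕ} {d : ι → k} {e : κ → k}
    (h : FormIsom k d (Sum.elim (hypForm k m) e)) : SplitsH k m d :=
  ⟨Fintype.card κ, e ∘ (Fintype.equivFin κ).symm, h.tr (formIsom_sum (formIsom_refl _)
    (formIsom_reindex _ _ (Fintype.equivFin κ) (by simp)))⟩

lemma splitsH_zero {k : Type} [Field k] {ι : Type} [Fintype ι] (d : ι → k) : SplitsH k 0 d := by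
  haveI : IsEmpty (Fin (2 * 0)) := by rw [mul_zero]; infer_instance
  refine splitsH_of (e := d) (formIsom_reindex _ _ ((Equiv.emptySum (Fin (2 * 0)) ι).symm) fun j => ?_)
  simp

lemma splitsH_succ {k : Type} [Field k] {ι κ : Type} [Fintype ι] [Fintype κ] {m : ℕ} {d : ι → k} {e : κ → k}
    (h : FormIsom k d (Sum.elim ![1, -1] e)) (he : SplitsH k m e) : SplitsH k (m + 1) d := by
  obtain ⟨s, f, hf⟩ := he
  refine ⟨s, f, (h.tr (formIsom_sum (formIsom_refl _) hf)).tr ?_⟩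
  refine (formIsom_reindex _ (Sum.elim (Sum.elim (hypForm k m) ![1, -1]) f)
    (((Equiv.sumAssoc _ _ _).symm).trans (Equiv.sumCongr (Equiv.sumComm _ _) (Equiv.refl _))) ?_).tr
    (formIsom_sum ?_ (formIsom_refl _))
  · rintro (j | j | j) <;> simp
  · refine formIsom_reindex _ _ (finSumFinEquiv.trans (finCongr (by ring))) ?_
    rintro (j | j)
    · rw [Equiv.trans_apply, finSumFinEquiv_apply_left]
      simp [hypForm]
    · rw [Equiv.trans_apply, finSumFinEquiv_apply_right]
      fin_cases j
      · simp [hypForm]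
      · have : (2 * m + 1) % 2 = 1 := by omega
        simp [hypForm]

lemma splitsH_inj {k : Type} [Field k] {ι : Type} [Fintype ι] {a : ℕ} (d : ι → k) (σ : Fin a × Fin 2 → ι)
    (hσ : Function.Injective σ) (h : ∀ j, FormIsom k ![d (σ (j, 0)), d (σ (j, 1))] ![1, -1]) :
    SplitsH k a d := by
  classical
  have h1 : FormIsom k d (Sum.elim (fun j => d (σ j)) (fun x : {x // x ∉ Set.range σ} => d x)) := by
    refine (formIsom_reindex _ _ ((Equiv.sumCongr (Equiv.ofInjective σ hσ) (Equiv.refl _)).trans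
      (Equiv.sumCompl (fun x => x ∈ Set.range σ))) ?_).sy
    rintro (j | j) <;> simp
  refine splitsH_of (h1.tr (formIsom_sum ?_ (formIsom_refl _)))
  refine (formIsom_fam (e := fun p : Fin a × Fin 2 => (![1, -1] : Fin 2 → k) p.2) fun j => ?_).tr ?_
  · convert h j using 1
    funext t
    fin_cases t <;> rfl
  · refine formIsom_reindex _ _ (finProdFinEquiv.trans (finCongr (mul_comm _ _))) ?_
    rintro ⟨j, t⟩
    fin_cases t <;> simp [hypForm, finProdFinEquiv] <;> omega

lemma zm0_pow_lt {γ b : Zm0} (hγ : γ < 1) (hb : b ≠ 0) : ∃ n : ℕ, γ ^ n < b := by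
  rcases eq_or_ne γ 0 with rfl | h0
  · exact ⟨1, by simpa using zero_lt_iff.2 hb⟩
  · obtain ⟨n, hn⟩ := MulArchimedean.arch b⁻¹ ((one_lt_inv₀ (zero_lt_iff.2 h0)).2 hγ)
    refine ⟨n + 1, ?_⟩
    have h1 : γ ^ n ≤ b := by
      rw [inv_pow] at hn
      exact (inv_le_inv₀ (zero_lt_iff.2 hb) (pow_pos (zero_lt_iff.2 h0) n)).1 hn
    refine lt_of_lt_of_le ?_ h1
    exact pow_lt_pow_right_of_lt_one₀ (zero_lt_iff.2 h0) hγ (Nat.lt_succ_self n)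

/-- Newton iteration -/
noncomputable def newt {K : Type} [Field K] (u : K) : ℕ → K
  | 0 => 1
  | n + 1 => (newt u n + u / newt u n) / 2

lemma newt_spec {K : Type} [Field K] (v : Valuation K Zm0) (h2 : v 2 = 1) (u : K) (hu : v (u - 1) < 1) (n : ℕ) :
    v (newt u n) = 1 ∧ v (newt u n ^ 2 - u) ≤ v (u - 1) ^ (n + 1) ∧
    v (newt u (n + 1) - newt u n) ≤ v (u - 1) ^ (n + 1) := by
  have h20 : (2 : K) ≠ 0 := by intro h; rw [h] at h2; simp at h2
  have hstep : ∀ n, v (newt u n) = 1 → v (newt u (n + 1) - newt u n) = v (newt u n ^ 2 - u) := by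
    intro n h
    have h0 : newt u n ≠ 0 := by intro h'; rw [h'] at h; simp at h
    have : newt u (n + 1) - newt u n = -(newt u n ^ 2 - u) / (2 * newt u n) := by
      simp only [newt]; field_simp; ring
    rw [this, map_div₀, Valuation.map_neg, map_mul, h2, h]; simp
  suffices h : v (newt u n) = 1 ∧ v (newt u n ^ 2 - u) ≤ v (u - 1) ^ (n + 1) from
    ⟨h.1, h.2, (hstep n h.1).le.trans h.2⟩
  induction n with
  | zero =>
    simp only [newt, map_one, one_pow, zero_add, pow_one, true_and]
    rw [Valuation.map_sub_swap]
  | succ n ih =>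
    obtain ⟨h1, h3⟩ := ih
    have h0 : newt u n ≠ 0 := by intro h'; rw [h'] at h1; simp at h1
    have hlt : v (newt u (n + 1) - newt u n) < 1 := by
      rw [hstep n h1]
      exact h3.trans_lt (pow_lt_one₀ zero_le hu (by omega))
    refine ⟨?_, ?_⟩
    · have := Valuation.map_add_eq_of_lt_right v (x := newt u (n + 1) - newt u n) (y := newt u n) (by rw [h1]; exact hlt)
      rw [sub_add_cancel, h1] at this
      exact this
    · have : newt u (n + 1) ^ 2 - u = (newt u n ^ 2 - u) ^ 2 / (2 * newt u n) ^ 2 := by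
        simp only [newt]; field_simp; ring
      rw [this, map_div₀, map_pow, map_pow, map_mul, h2, h1]
      simp only [mul_one, one_pow, div_one]
      calc v (newt u n ^ 2 - u) ^ 2 ≤ (v (u - 1) ^ (n + 1)) ^ 2 := pow_le_pow_left₀ zero_le h3 2
        _ = v (u - 1) ^ ((n + 1) * 2) := by rw [pow_mul]
        _ ≤ _ := pow_le_pow_of_le_one zero_le hu.le (by omega)

lemma hensel_sq {K : Type} [Field K] (v : Valuation K Zm0) (h2 : v 2 = 1) (u : K) (hu : v (u - 1) < 1) :
    ∃ z : valCompletion v, z ^ 2 = toValCompletion v u := by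
  letI := Valued.mk' v
  have htend : ∀ f : ℕ → K, (∀ n, v (f n) ≤ v (u - 1) ^ (n + 1)) → Filter.Tendsto f Filter.atTop (nhds 0) := by
    intro f hf
    rw [(Valued.hasBasis_nhds_zero K Zm0).tendsto_right_iff]
    rintro γ -
    obtain ⟨n, hn⟩ := zm0_pow_lt hu (b := MonoidWithZeroHom.ValueGroup₀.embedding γ.1) (by simp)
    filter_upwards [Filter.eventually_ge_atTop n] with k hk
    show v.restrict (f k) < γ.1
    rw [Valuation.restrict_lt_iff_lt_embedding]
    exact ((hf k).trans (pow_le_pow_of_le_one zero_le hu.le (by omega))).trans_lt hn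
  haveI : NonarchimedeanRing K := v.subgroups_basis.nonarchimedean
  have hc : CauchySeq (newt u) :=
    NonarchimedeanAddGroup.cauchySeq_of_tendsto_sub_nhds_zero (htend _ fun n => (newt_spec v h2 u hu n).2.2)
  have hc' : CauchySeq (fun n => ((newt u n : K) : UniformSpace.Completion K)) :=
    hc.map (UniformSpace.Completion.uniformContinuous_coe K)
  obtain ⟨z, hz⟩ := cauchySeq_tendsto_of_complete hc'
  have h1 : Filter.Tendsto (fun n => ((newt u n ^ 2 - u : K) : UniformSpace.Completion K)) Filter.atTop
      (nhds ((0 : K) : UniformSpace.Completion K)) :=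
    ((UniformSpace.Completion.continuous_coe K).tendsto 0).comp (htend _ fun n => (newt_spec v h2 u hu n).2.1)
  have h3 : Filter.Tendsto (fun n => ((newt u n ^ 2 - u : K) : UniformSpace.Completion K)) Filter.atTop
      (nhds (z ^ 2 - (u : UniformSpace.Completion K))) := by
    have : (fun n => ((newt u n ^ 2 - u : K) : UniformSpace.Completion K)) =
        fun n => ((newt u n : K) : UniformSpace.Completion K) ^ 2 - (u : UniformSpace.Completion K) := by
      funext n
      rw [UniformSpace.Completion.coe_sub, sq, sq, UniformSpace.Completion.coe_mul]
    rw [this]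
    exact (hz.pow 2).sub_const _
  have h4 := tendsto_nhds_unique h3 h1
  rw [UniformSpace.Completion.coe_zero, sub_eq_zero] at h4
  exact ⟨z, h4⟩

lemma exists_pi {K : Type} [Field K] (v : Valuation K Zm0) (hv : isNontrivialVal v) :
    ∃ p : K, p ≠ 0 ∧ ∀ t : K, t ≠ 0 → v p ≠ v t ^ 2 := by
  classical
  have hex : ∃ n : ℕ, n ≠ 0 ∧ ∃ x : K, x ≠ 0 ∧ (WithZero.log (v x)).natAbs = n := by
    obtain ⟨x, h0, h1⟩ := hv
    refine ⟨_, ?_, x, ?_, rfl⟩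
    · intro h
      rw [Int.natAbs_eq_zero] at h
      apply h1
      rw [← WithZero.exp_log h0, h, WithZero.exp_zero]
    · rintro rfl; simp at h0
  obtain ⟨h0, p, hp, hpn⟩ := Nat.find_spec hex
  refine ⟨p, hp, fun t ht h => ?_⟩
  have hlog : WithZero.log (v p) = 2 * WithZero.log (v t) := by
    rw [h, WithZero.log_pow]; simp
  have hpn' : (WithZero.log (v t)).natAbs < Nat.find hex := by omega
  exact Nat.find_min hex hpn' ⟨by omega, t, ht, rfl⟩

lemma mod_iso {K : Type} [Field K] (v : Valuation K Zm0) (hv : isNontrivialVal v) (M : ℕ)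
    (hU : ∀ (ι : Type) (_ : Fintype ι) (d : ι → K), M < Fintype.card ι → ¬ AnisoR d)
    {ι : Type} [Fintype ι] (d : ι → K) (hd : ∀ j, v (d j) = 1) (hc : M < 2 * Fintype.card ι) :
    ∃ c : ι → K, (∀ j, v (c j) ≤ 1) ∧ (∃ j, v (c j) = 1) ∧ v (∑ j, d j * c j ^ 2) < 1 := by
  by_contra hcon
  have key : ∀ w : ι → K, w ≠ 0 → ∃ t : K, t ≠ 0 ∧ v (∑ j, d j * w j ^ 2) = v t ^ 2 := by
    intro w hw
    obtain ⟨j0, hj0⟩ := Function.ne_iff.1 hw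
    obtain ⟨j, -, hj⟩ := Finset.exists_max_image Finset.univ (fun j => v (w j)) ⟨j0, Finset.mem_univ _⟩
    have hwj : w j ≠ 0 := by
      intro h
      have := hj j0 (Finset.mem_univ _)
      rw [h, map_zero] at this
      exact hj0 (by simpa using this)
    have hvj : v (w j) ≠ 0 := by simpa using hwj
    refine ⟨w j, hwj, ?_⟩
    have hle : ∀ k, v (w k / w j) ≤ 1 := by
      intro k
      rw [map_div₀]
      exact div_le_one_of_le₀ (hj k (Finset.mem_univ _)) zero_le
    have h1 : ¬ v (∑ k, d k * (w k / w j) ^ 2) < 1 := fun h =>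
      hcon ⟨fun k => w k / w j, hle, ⟨j, by beta_reduce; rw [div_self hwj, map_one]⟩, h⟩
    have h2 : v (∑ k, d k * (w k / w j) ^ 2) ≤ 1 := by
      refine Valuation.map_sum_le v fun k _ => ?_
      rw [map_mul, hd, one_mul, map_pow]
      exact pow_le_one₀ zero_le (hle k)
    have h3 := le_antisymm h2 (not_lt.1 h1)
    have h4 : ∑ k, d k * w k ^ 2 = (w j) ^ 2 * ∑ k, d k * (w k / w j) ^ 2 := by
      rw [Finset.mul_sum]
      refine Finset.sum_congr rfl fun k _ => ?_
      field_simp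
    rw [h4, map_mul, h3, mul_one, map_pow]
  obtain ⟨p, hp, hpt⟩ := exists_pi v hv
  apply hU (ι ⊕ ι) inferInstance (Sum.elim d (fun j => p * d j)) (by simp; omega)
  intro w hw
  have hw' : ∑ j, d j * w (Sum.inl j) ^ 2 + p * ∑ j, d j * w (Sum.inr j) ^ 2 = 0 := by
    rw [← hw, Fintype.sum_sum_type, Finset.mul_sum]
    simp [mul_assoc]
  have hvp : v p ≠ 0 := by simpa using hp
  by_cases h1 : (fun j => w (Sum.inl j)) = 0
  · by_cases h2 : (fun j => w (Sum.inr j)) = 0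
    · funext j
      rcases j with j | j
      · exact congrFun h1 j
      · exact congrFun h2 j
    · exfalso
      obtain ⟨t, ht, h⟩ := key _ h2
      have h3 : ∑ j, d j * w (Sum.inl j) ^ 2 = 0 :=
        Finset.sum_eq_zero fun j _ => by rw [show w (Sum.inl j) = 0 from congrFun h1 j]; simp
      rw [h3, zero_add] at hw'
      rw [(mul_eq_zero.1 hw').resolve_left hp, map_zero] at h
      exact ht (by simpa using h.symm)
  · exfalso
    obtain ⟨t, ht, h⟩ := key _ h1
    have hvt : v t ≠ 0 := by simpa using ht
    have h5 : v t ^ 2 = v p * v (∑ j, d j * w (Sum.inr j) ^ 2) := by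
      rw [← h, ← map_mul, eq_neg_of_add_eq_zero_left hw', Valuation.map_neg]
    by_cases h2 : (fun j => w (Sum.inr j)) = 0
    · have h3 : ∑ j, d j * w (Sum.inr j) ^ 2 = 0 :=
        Finset.sum_eq_zero fun j _ => by rw [show w (Sum.inr j) = 0 from congrFun h2 j]; simp
      rw [h3, map_zero, mul_zero] at h5
      exact ht (by simpa using h5)
    · obtain ⟨t', ht', h'⟩ := key _ h2
      have hvt' : v t' ≠ 0 := by simpa using ht'
      rw [h'] at h5
      apply hpt (t / t') (div_ne_zero ht ht')
      rw [map_div₀, div_pow, h5]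
      field_simp

lemma toVal_inj {K : Type} [Field K] (v : Valuation K Zm0) : Function.Injective (toValCompletion v) :=
  (toValCompletion v).injective

lemma two_ne {K : Type} [Field K] (v : Valuation K Zm0) (h2 : v 2 = 1) : (2 : valCompletion v) ≠ 0 := by
  have : (2 : valCompletion v) = toValCompletion v 2 := (map_ofNat _ 2).symm
  rw [this]
  intro h
  rw [map_eq_zero] at h
  rw [h] at h2
  simp at h2

lemma unit_ne {K : Type} [Field K] {v : Valuation K Zm0} {a : K} (h : v a = 1) : a ≠ 0 := by
  rintro rfl; simp at h

/-- a binary form with square negative ratio is hyperbolic -/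
lemma bin_hyp {K : Type} [Field K] (v : Valuation K Zm0) (h2 : v 2 = 1) (a b : K) (ha : a ≠ 0)
    (hb : b ≠ 0) (h : ∃ z : valCompletion v, z ^ 2 = toValCompletion v (-b / a)) :
    FormIsom (valCompletion v) ![toValCompletion v a, toValCompletion v b] ![1, -1] := by
  obtain ⟨z, hz⟩ := h
  have ha' : toValCompletion v a ≠ 0 := by simpa using ha
  have hb' : toValCompletion v b ≠ 0 := by simpa using hb
  have hz0 : z ≠ 0 := by
    rintro rfl
    rw [map_div₀, map_neg, zero_pow two_ne_zero] at hz
    exact div_ne_zero (neg_ne_zero.2 hb') ha' hz.symm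
  refine (formIsom_scale (e := ![toValCompletion v a, -toValCompletion v a]) (s := ![1, z]) ?_ ?_).tr
    (formIsom_hyp (two_ne v h2) _ ha')
  · intro j; fin_cases j <;> simp [hz0]
  · intro j; fin_cases j
    · simp
    · simp [hz]; field_simp

lemma chain_iso {K : Type} [Field K] (v : Valuation K Zm0) (h2 : v 2 = 1) : ∀ (k : ℕ) (a : Fin (k + 1) → K),
    (∀ j, v (a j) = 1) → v (∑ j, a j) < 1 →
    ∃ (κ : Type) (_ : Fintype κ) (e : κ → K), (∀ j, v (e j) = 1) ∧
      FormIsom (valCompletion v) (fun j => toValCompletion v (a j))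
        (Sum.elim ![1, -1] (fun j => toValCompletion v (e j))) := by
  intro k
  induction k with
  | zero =>
    intro a ha h
    simp [ha] at h
  | succ k ih =>
    intro a ha h
    have hsplit : FormIsom (valCompletion v) (fun j => toValCompletion v (a j))
        (Sum.elim ![toValCompletion v (a 0), toValCompletion v (a 1)]
          (fun j : Fin k => toValCompletion v (a j.succ.succ))) := by
      refine (formIsom_reindex _ _ (finSumFinEquiv.trans (finCongr (by omega))) ?_).sy
      rintro (j | j)
      · rw [Equiv.trans_apply, finSumFinEquiv_apply_left]
        fin_cases j
        · simp; rfl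
        · simp; rfl
      · rw [Equiv.trans_apply, finSumFinEquiv_apply_right]
        simp only [Sum.elim_inr]
        congr 2
        ext
        simp
    by_cases hlt : v (a 0 + a 1) < 1
    · refine ⟨Fin k, inferInstance, fun j => a j.succ.succ, fun j => ha _, hsplit.tr (formIsom_sum ?_ (formIsom_refl _))⟩
      refine bin_hyp v h2 _ _ (unit_ne (ha 0)) (unit_ne (ha 1)) (hensel_sq v h2 _ ?_)
      have h0 := unit_ne (ha 0)
      have : -a 1 / a 0 - 1 = -(a 0 + a 1) / a 0 := by field_simp; ring
      rw [this, map_div₀, Valuation.map_neg, ha, div_one]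
      exact hlt
    · have h1 : v (a 0 + a 1) = 1 := by
        refine le_antisymm ?_ (not_lt.1 hlt)
        exact Valuation.map_add_le v (ha 0).le (ha 1).le
      obtain ⟨κ, _, e, he, hi⟩ := ih (Fin.cons (a 0 + a 1) (fun j : Fin k => a j.succ.succ))
        (by
          intro j
          refine Fin.cases ?_ (fun j => ?_) j
          · simpa using h1
          · simpa using ha _)
        (by
          rw [Fin.sum_univ_succ] at h ⊢
          rw [Fin.sum_univ_succ] at h
          simp only [Fin.cons_zero, Fin.cons_succ]
          rw [add_assoc]
          exact h)
      refine ⟨κ ⊕ Fin 1, inferInstance, Sum.elim e (fun _ => a 0 * a 1 * (a 0 + a 1)), ?_, ?_⟩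
      · rintro (j | j)
        · exact he j
        · simp [ha, h1]
      · refine hsplit.tr ?_
        have hne : toValCompletion v (a 0) + toValCompletion v (a 1) ≠ 0 := by
          rw [← map_add]; exact (map_ne_zero _).2 (unit_ne h1)
        refine (formIsom_sum (formIsom_bin _ _ hne) (formIsom_refl _)).tr ?_
        have hb : FormIsom (valCompletion v)
            (Sum.elim ![toValCompletion v (a 0) + toValCompletion v (a 1),
              toValCompletion v (a 0) * toValCompletion v (a 1) * (toValCompletion v (a 0) + toValCompletion v (a 1))]
              (fun j : Fin k => toValCompletion v (a j.succ.succ)))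
            (Sum.elim (fun j => toValCompletion v ((Fin.cons (a 0 + a 1) (fun j : Fin k => a j.succ.succ) : Fin (k + 1) → K) j))
              (fun _ : Fin 1 => toValCompletion v (a 0 * a 1 * (a 0 + a 1)))) := by
          refine formIsom_reindex _ _ (((Equiv.sumCongr (finSumFinEquiv (m := 1) (n := 1)).symm (Equiv.refl (Fin k))).trans
            ((Equiv.sumAssoc _ _ _).trans ((Equiv.sumCongr (Equiv.refl _) (Equiv.sumComm _ _)).trans
            (Equiv.sumAssoc _ _ _).symm))).trans
            (Equiv.sumCongr (finSumFinEquiv.trans (finCongr (by omega))) (Equiv.refl _))) ?_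
          rintro (j | j)
          · fin_cases j
            · have : (finSumFinEquiv (m := 1) (n := 1)).symm 0 = Sum.inl 0 := by decide
              simp [this]
              rw [← map_add]
              rfl
            · have : (finSumFinEquiv (m := 1) (n := 1)).symm 1 = Sum.inr 0 := by decide
              simp [this]
          · simp
        refine hb.tr ((formIsom_sum hi (formIsom_refl _)).tr ?_)
        refine formIsom_reindex _ _ (Equiv.sumAssoc _ _ _) ?_
        rintro ((j | j) | j) <;> simp

lemma split_one {K : Type} [Field K] (v : Valuation K Zm0) (hv : isNontrivialVal v) (h2 : v 2 = 1) (M : ℕ)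
    (hU : ∀ (ι : Type) (_ : Fintype ι) (d : ι → K), M < Fintype.card ι → ¬ AnisoR d)
    {ι : Type} [Fintype ι] (d : ι → K) (hd : ∀ j, v (d j) = 1) (hc : M < 2 * Fintype.card ι) :
    ∃ (κ : Type) (_ : Fintype κ) (e : κ → K), (∀ j, v (e j) = 1) ∧
      FormIsom (valCompletion v) (fun j => toValCompletion v (d j))
        (Sum.elim ![1, -1] (fun j => toValCompletion v (e j))) := by
  classical
  obtain ⟨c, hc1, ⟨j0, hj0⟩, hs⟩ := mod_iso v hv M hU d hd hc
  let S := {j // v (c j) = 1}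
  obtain ⟨k, hk⟩ : ∃ k, Fintype.card S = k + 1 := by
    haveI : Nonempty S := ⟨⟨j0, hj0⟩⟩
    exact ⟨Fintype.card S - 1, by have := Fintype.card_pos (α := S); omega⟩
  let ε : S ≃ Fin (k + 1) := Fintype.equivFinOfCardEq hk
  have hsum : v (∑ j : S, d j * c j ^ 2) < 1 := by
    have h1 := Fintype.sum_subtype_add_sum_subtype (fun j => v (c j) = 1) (fun j => d j * c j ^ 2)
    rw [← eq_sub_iff_add_eq] at h1
    rw [h1]
    refine Valuation.map_sub_lt v hs ?_
    refine Valuation.map_sum_lt v one_ne_zero fun j _ => ?_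
    rw [map_mul, hd, one_mul, map_pow]
    exact pow_lt_one₀ zero_le (lt_of_le_of_ne (hc1 _) j.2) (by omega)
  obtain ⟨κ, _, e, he, hi⟩ := chain_iso v h2 k (fun t => d (ε.symm t) * c (ε.symm t) ^ 2)
    (fun t => by rw [map_mul, hd, one_mul, map_pow, (ε.symm t).2, one_pow])
    (by
      rw [← Equiv.sum_comp ε] 
      simpa using hsum)
  refine ⟨κ ⊕ {j // ¬ v (c j) = 1}, inferInstance, Sum.elim e (fun j => d j), ?_, ?_⟩
  · rintro (j | j)
    · exact he j
    · exact hd _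
  · have h1 : FormIsom (valCompletion v) (fun j => toValCompletion v (d j))
        (Sum.elim (fun j : S => toValCompletion v (d j)) (fun j : {j // ¬ v (c j) = 1} => toValCompletion v (d j))) := by
      refine (formIsom_reindex _ _ (Equiv.sumCompl (fun j => v (c j) = 1)) ?_).sy
      rintro (j | j) <;> simp
    refine h1.tr ?_
    have h3 : FormIsom (valCompletion v) (fun j : S => toValCompletion v (d j))
        (fun t => toValCompletion v (d (ε.symm t) * c (ε.symm t) ^ 2)) := by
      refine FormIsom.tr (e := fun j : S => toValCompletion v (d j * c j ^ 2)) ?_ (formIsom_reindex _ _ ε (by simp))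
      refine (formIsom_scale (s := fun j : S => toValCompletion v (c j)) ?_ ?_).sy
      · intro j; simpa using unit_ne j.2
      · intro j; simp
    refine (formIsom_sum (h3.tr hi) (formIsom_refl _)).tr ?_
    refine formIsom_reindex _ _ (Equiv.sumAssoc _ _ _) ?_
    rintro ((j | j) | j) <;> simp

lemma split_many {K : Type} [Field K] (v : Valuation K Zm0) (hv : isNontrivialVal v) (h2 : v 2 = 1) (M : ℕ)
    (hU : ∀ (ι : Type) (_ : Fintype ι) (d : ι → K), M < Fintype.card ι → ¬ AnisoR d) (m : ℕ) :
    ∀ {ι : Type} [Fintype ι] (d : ι → K) (_ : ∀ j, v (d j) = 1) (_ : M + 4 * m < 2 * Fintype.card ι + 4),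
      SplitsH (valCompletion v) m (fun j => toValCompletion v (d j)) := by
  induction m with
  | zero => intro ι _ d _ _; exact splitsH_zero _
  | succ m ih =>
    intro ι _ d hd hc
    obtain ⟨κ, _, e, he, hi⟩ := split_one v hv h2 M hU d hd (by omega)
    have := formIsom_card hi
    simp only [Fintype.card_sum, Fintype.card_fin] at this
    exact splitsH_succ hi (ih e he (by omega))

lemma aniso_ne {R : Type*} [CommRing R] [Nontrivial R] {ι : Type*} [Fintype ι] {d : ι → R} (h : AnisoR d) (j : ι) :
    d j ≠ 0 := by
  classical
  intro h0
  have := h (Pi.single j 1) (by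
    refine Finset.sum_eq_zero fun t _ => ?_
    by_cases ht : t = j
    · subst ht; rw [h0, zero_mul]
    · rw [Pi.single_eq_of_ne ht]; simp)
  have := congrFun this j
  simp at this

lemma near_one_ne {K : Type} [Field K] {v : Valuation K Zm0} {u : K} (h : v (u - 1) < 1) : u ≠ 0 := by
  rintro rfl
  simp at h

/-- the explicit form -/
def bigD {K : Type} [Field K] {a n : ℕ} (c : Fin a ⊕ Fin n → K) (x y : K) :
    (Fin a × Fin 4) ⊕ (Fin n × Fin 3) → K :=
  Sum.elim (fun p => c (Sum.inl p.1) * psiR x y p.2) (fun p => c (Sum.inr p.1) * psiR x y p.2.castSucc)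

lemma local_part {K : Type} [Field K] (v : Valuation K Zm0) (hv : isNontrivialVal v) (h2 : v 2 = 1)
    {a n : ℕ}
    (hU : ∀ (ι : Type) (_ : Fintype ι) (d : ι → K), 4 * (a + n) < Fintype.card ι → ¬ AnisoR d)
    (c : Fin a ⊕ Fin n → K) (hc : ∀ j, v (c j) = 1) (x y : K) (hx : v x = 1) :
    SplitsH (valCompletion v) a (fun j => toValCompletion v (bigD c x y j)) := by
  set f := y ^ 4 - y ^ 3 + y with hf
  have hx0 := unit_ne hx
  have hA : f ≠ 0 → (∃ z : valCompletion v, z ^ 2 = toValCompletion v f) →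
      SplitsH (valCompletion v) a (fun j => toValCompletion v (bigD c x y j)) := by
    intro hf0 hz
    refine splitsH_inj _ (fun p => Sum.inl (p.1, Fin.castLE (by omega) p.2)) ?_ ?_
    · rintro ⟨j, t⟩ ⟨j', t'⟩ h
      simpa using h
    · intro j
      have hc0 := unit_ne (hc (Sum.inl j))
      refine bin_hyp v h2 _ _ ?_ ?_ ?_
      · simpa [bigD, psiR] using hc0
      · simp only [bigD, psiR, Sum.elim_inl]
        exact mul_ne_zero hc0 (neg_ne_zero.2 hf0)
      · convert hz using 4
        simp only [bigD, psiR, Sum.elim_inl]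
        show -(c (Sum.inl j) * -f) / (c (Sum.inl j) * 1) = f
        field_simp
  have hB : 1 - f ≠ 0 → (∃ z : valCompletion v, z ^ 2 = toValCompletion v (1 - f)) →
      SplitsH (valCompletion v) a (fun j => toValCompletion v (bigD c x y j)) := by
    intro hf0 hz
    refine splitsH_inj _ (fun p => Sum.inl (p.1, Fin.natAdd 2 p.2)) ?_ ?_
    · rintro ⟨j, t⟩ ⟨j', t'⟩ h
      simpa [Fin.ext_iff] using h
    · intro j
      have hc0 := unit_ne (hc (Sum.inl j))
      refine bin_hyp v h2 _ _ ?_ ?_ ?_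
      · simp only [bigD, Sum.elim_inl]
        exact mul_ne_zero hc0 hx0
      · simp only [bigD, Sum.elim_inl]
        exact mul_ne_zero hc0 (neg_ne_zero.2 (mul_ne_zero hx0 hf0))
      · convert hz using 4
        simp only [bigD, Sum.elim_inl]
        show -(c (Sum.inl j) * -(x * (1 - f))) / (c (Sum.inl j) * x) = 1 - f
        field_simp
  by_cases hy : 1 < v y
  · have hy0 : y ≠ 0 := by rintro rfl; simp at hy
    have hinv : v y⁻¹ < 1 := by
      rw [map_inv₀]; exact inv_lt_one_of_one_lt₀ hy
    have h1 : v (f / y ^ 4 - 1) < 1 := by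
      have : f / y ^ 4 - 1 = (y⁻¹) ^ 3 - y⁻¹ := by rw [hf]; field_simp; ring
      rw [this]
      refine Valuation.map_sub_lt v ?_ hinv
      rw [map_pow]
      exact pow_lt_one₀ zero_le hinv (by omega)
    have hne := near_one_ne h1
    apply hA
    · intro h; rw [h] at hne; simp at hne
    · obtain ⟨z, hz⟩ := hensel_sq v h2 _ h1
      refine ⟨z * toValCompletion v (y ^ 2), ?_⟩
      rw [mul_pow, hz, ← map_pow, ← map_mul]
      congr 1
      field_simp
  · rw [not_lt] at hy
    have hf1 : v f ≤ 1 := by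
      rw [hf]
      refine Valuation.map_add_le v (Valuation.map_sub_le v ?_ ?_) hy
      · rw [map_pow]; exact pow_le_one₀ zero_le hy
      · rw [map_pow]; exact pow_le_one₀ zero_le hy
    by_cases hlt : v f < 1
    · have h1 : v ((1 - f) - 1) < 1 := by
        have : (1 - f) - 1 = -f := by ring
        rw [this, Valuation.map_neg]; exact hlt
      exact hB (near_one_ne h1) (hensel_sq v h2 _ h1)
    · have hf2 : v f = 1 := le_antisymm hf1 (not_lt.1 hlt)
      by_cases hlt' : v (1 - f) < 1
      · have h1 : v (f - 1) < 1 := by rwa [Valuation.map_sub_swap]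
        exact hA (near_one_ne h1) (hensel_sq v h2 _ h1)
      · have hf3 : v (1 - f) = 1 :=
          le_antisymm (Valuation.map_sub_le v (map_one v).le hf1) (not_lt.1 hlt')
        have hpsi : ∀ t, v (psiR x y t) = 1 := by
          intro t
          fin_cases t
          · simp [psiR]
          · show v (-f) = 1
            rw [Valuation.map_neg, hf2]
          · exact hx
          · show v (-(x * (1 - f))) = 1
            rw [Valuation.map_neg, map_mul, hx, hf3, one_mul]
        refine split_many v hv h2 _ hU a _ ?_ ?_
        · rintro (j | j)
          · simp [bigD, hc, hpsi]
          · simp [bigD, hc, hpsi]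
        · simp; omega

lemma exists_aniso_u (ℓ : Type) [Field ℓ] (i : ℕ) (hu : uInv ℓ = ((2 ^ i : ℕ) : ℕ∞)) :
    ∃ d : Fin (2 ^ i) → ℓ, AnisoR d := by
  have hmem : uInv ℓ ∈ {N : ℕ∞ | ∃ n : ℕ, N = n ∧
    ∃ d : Fin n → ℓ, (∀ t, d t ≠ 0) ∧ (diagQF ℓ d).Anisotropic} := by
    have hne : Nonempty {N : ℕ∞ | ∃ n : ℕ, N = n ∧
        ∃ d : Fin n → ℓ, (∀ t, d t ≠ 0) ∧ (diagQF ℓ d).Anisotropic} := by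
      refine ⟨0, 0, by simp, fun t => 0, fun t => t.elim0, ?_⟩
      intro w _
      exact Subsingleton.elim _ _
    apply ENat.sSup_mem_of_nonempty_of_lt_top
    · have : uInv ℓ < ⊤ := by rw [hu]; exact ENat.coe_lt_top _
      exact this
  obtain ⟨n, hn, d, _, hd⟩ := hmem
  rw [hu] at hn
  have hn' : 2 ^ i = n := by exact_mod_cast hn
  subst hn'
  refine ⟨d, fun w hw => hd w ?_⟩
  rw [diagQF_app]; exact hw

/-- **Theorem (counterexamples to the refined local-global principle).**  Let `ℓ` be a
field of characteristic ≠ 2 with `ℓ ∈ 𝒜_i(2)` for some `i ≥ 0` and `u(ℓ) = 2^i`.  For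
`r ≥ 1` let `L_r = ℓ(x₁, …, x_r)`, and for `r ≥ 2` let `V_r` be the set of non-trivial
discrete valuations on `L_r` that are trivial on `L_{r-1}`.  Then for every `r ≥ 2` and
every integer `n` with `0 ≤ n < 2^{i+r-2}`, there exists a `(2^{i+r} - n)`-dimensional
quadratic form `q` over `L_r` that is anisotropic over `L_r` but satisfies
`i_W(q_{(L_r)_v}) ≥ 2^{i+r-2} - n` for every `v ∈ V_r`; i.e. `q` violates
`LGP(2^{i+r-2} - n, 1)` with respect to `V_r`.  ("Trivial on `L_{r-1}`" is expressed as: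
`v` takes the value 1 on every nonzero polynomial in the first `r - 1` variables, which
is equivalent to triviality on the subfield `L_{r-1}` they generate.) -/
theorem statement0 (ℓ : Type) [Field ℓ] (hchar : ringChar ℓ ≠ 2)
    (i : ℕ) (hA : propertyA ℓ i) (hu : uInv ℓ = ((2 ^ i : ℕ) : ℕ∞))
    (r : ℕ) (hr : 2 ≤ r) (n : ℕ) (hn : n < 2 ^ (i + r - 2)) :
    ∃ d : Fin (2 ^ (i + r) - n) → Lfield ℓ r,
      (∀ t, d t ≠ 0) ∧ (diagQF (Lfield ℓ r) d).Anisotropic ∧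
      ∀ v : Valuation (Lfield ℓ r) Zm0, isNontrivialVal v →
        (∀ p : MvPolynomial (Fin (r - 1)) ℓ, p ≠ 0 →
          v (algebraMap (MvPolynomial (Fin r) ℓ) (Lfield ℓ r)
              (MvPolynomial.rename (Fin.castLE (Nat.sub_le r 1)) p)) = 1) →
        2 ^ (i + r - 2) - n ≤
          wittIndex (valCompletion v) (toValCompletion v ∘ d) := by
  obtain ⟨m, rfl⟩ : ∃ m, r = m + 2 := ⟨r - 2, by omega⟩
  have him : i + (m + 2) - 2 = i + m := by omega
  rw [him] at hn ⊢
  have h2 : (2 : ℓ) ≠ 0 := Ring.two_ne_zero hchar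
  obtain ⟨φ, hφ⟩ := exists_aniso_u ℓ i hu
  obtain ⟨J, _, c, hJ, hc⟩ := exists_phi φ hφ (m + 2) m (by omega)
  have hfull := anisoR_frac _ (aniso_full h2 c hc)
  obtain ⟨a, ha⟩ : ∃ a, 2 ^ (i + m) = a + n := ⟨2 ^ (i + m) - n, by omega⟩
  have hpow : 2 ^ (i + (m + 2)) = 4 * (a + n) := by
    rw [← ha, ← add_assoc, pow_add]; ring
  have hcardJ : Fintype.card J = Fintype.card (Fin a ⊕ Fin n) := by
    rw [hJ, ← pow_add, ha]; simp
  let E : J ≃ Fin a ⊕ Fin n := Fintype.equivOfCardEq hcardJ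
  let R := MvPolynomial (Fin (m + 2)) ℓ
  let A := algebraMap (MvPolynomial (Fin (m + 2)) ℓ) (Lfield ℓ (m + 2))
  let c' : Fin a ⊕ Fin n → Lfield ℓ (m + 2) := fun j =>
    A (MvPolynomial.rename (Fin.castLE (by omega : m ≤ m + 2)) (c (E.symm j)))
  let x : Lfield ℓ (m + 2) := A (MvPolynomial.X ⟨m, by omega⟩)
  let y : Lfield ℓ (m + 2) := A (MvPolynomial.X ⟨m + 1, by omega⟩)
  have hpsi : ∀ t, A (psiR (MvPolynomial.X ⟨m, by omega⟩) (MvPolynomial.X ⟨m + 1, by omega⟩) t) = psiR x y t := by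
    intro t
    fin_cases t <;> simp [psiR, x, y]
  have hbig : AnisoR (bigD c' x y) := by
    refine anisoR_reindex _ _ (Sum.elim (fun p => (E.symm (Sum.inl p.1), p.2))
      (fun p => (E.symm (Sum.inr p.1), p.2.castSucc))) ?_ ?_ hfull
    · rintro (⟨j, t⟩ | ⟨j, t⟩) (⟨j', t'⟩ | ⟨j', t'⟩) h
      · simpa using h
      · simp at h
      · simp at h
      · simpa using h
    · rintro (⟨j, t⟩ | ⟨j, t⟩)
      · show c' (Sum.inl j) * psiR x y t = A _
        rw [map_mul, ← hpsi]
        rfl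
      · show c' (Sum.inr j) * psiR x y t.castSucc = A _
        rw [map_mul, ← hpsi]
        rfl
  have hcardI : Fintype.card (Fin (2 ^ (i + (m + 2)) - n)) = Fintype.card ((Fin a × Fin 4) ⊕ (Fin n × Fin 3)) := by
    simp only [Fintype.card_fin, Fintype.card_sum, Fintype.card_prod]
    omega
  let F := Fintype.equivOfCardEq hcardI
  have han : AnisoR (fun t => bigD c' x y (F t)) := anisoR_reindex _ _ F F.injective (fun _ => rfl) hbig
  refine ⟨fun t => bigD c' x y (F t), fun t => aniso_ne han t, ?_, ?_⟩
  · intro w hw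
    rw [diagQF_app] at hw
    exact han w hw
  · intro v hv htriv
    have hva : 2 ^ (i + m) - n = a := by omega
    rw [hva]
    apply splitsH_le
    refine splitsH_congr (formIsom_reindex _ (fun j => toValCompletion v (bigD c' x y j)) F fun j => rfl) ?_
    refine local_part v hv ?_ ?_ c' ?_ x y ?_
    · have := htriv (MvPolynomial.C 2) (by simpa using h2)
      rw [MvPolynomial.rename_C] at this
      rw [show (MvPolynomial.C 2 : MvPolynomial (Fin (m + 2)) ℓ) = 2 from map_ofNat _ 2, map_ofNat] at this
      exact this
    · intro ι _ d hd
      exact u_bound ℓ i hA (m + 2) (by rw [hpow]; exact hd) d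
    · intro j
      have := htriv (MvPolynomial.rename (Fin.castLE (by omega : m ≤ m + 2 - 1)) (c (E.symm j))) (by
        rw [Ne, map_eq_zero_iff _ (MvPolynomial.rename_injective _ (Fin.castLE_injective _))]
        intro h
        apply aniso_ne hc (E.symm j)
        rw [h, map_zero])
      rw [MvPolynomial.rename_rename] at this
      exact this
    · have := htriv (MvPolynomial.X ⟨m, by omega⟩) (MvPolynomial.X_ne_zero _)
      rw [MvPolynomial.rename_X] at this
      exact this
end

section
/- Let k be any field of characteristic ≠ 2, and let q be any anisotropic quadratic form over k. Then over the rational function field k(x_1, x_2), the quadratic form φ = ⟨x_2 + 1, −x_1 − x_2, x_1, x_1·x_2⟩ ⊗ q is anisotropic. -/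
/-- The rational function field `k(x₁, x₂)`, modeled as the fraction field of the
polynomial ring in two variables. -/
noncomputable abbrev L2 (k : Type) [Field k] : Type :=
  FractionRing (MvPolynomial (Fin 2) k)

/-- The variable `x_{j+1}` as an element of `k(x₁, x₂)`. -/
noncomputable def xvar (k : Type) [Field k] (j : Fin 2) : L2 k :=
  algebraMap (MvPolynomial (Fin 2) k) (L2 k) (MvPolynomial.X j)

/-- The inclusion of constants `k → k(x₁, x₂)`. -/
noncomputable def constMap (k : Type) [Field k] : k →+* L2 k :=
  (algebraMap (MvPolynomial (Fin 2) k) (L2 k)).comp (MvPolynomial.C)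

def Aniso {R ι : Type} [CommRing R] [Fintype ι] (a : ι → R) : Prop :=
  ∀ f : ι → R, ∑ i, a i * (f i * f i) = 0 → ∀ i, f i = 0

theorem Aniso.of_inj {R S ι : Type} [CommRing R] [CommRing S] [Fintype ι] {a : ι → R}
    (φ : R →+* S) (hφ : Function.Injective φ) (h : Aniso (fun i => φ (a i))) : Aniso a := by
  intro f hf i
  apply hφ
  rw [map_zero]
  refine h (fun i => φ (f i)) ?_ i
  have := congrArg φ hf
  simpa [map_sum] using this

open Polynomial in
theorem aniso_poly {S ι κ : Type} [CommRing S] [IsDomain S] [Fintype ι] [Fintype κ]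
    (a : ι → S[X]) (b : κ → S[X]) (ha : Aniso (fun i => (a i).coeff 0))
    (hb : Aniso (fun i => (b i).coeff 0)) :
    Aniso (Sum.elim a (fun j => X * b j)) := by
  have key : ∀ n : ℕ, ∀ (f : ι → S[X]) (g : κ → S[X]),
      ∑ i, a i * (f i * f i) + X * ∑ j, b j * (g j * g j) = 0 →
      (∀ i, X ^ n ∣ f i) ∧ (∀ j, X ^ n ∣ g j) := by
    intro n
    induction n with
    | zero => intro f g _; simp
    | succ n ih =>
      intro f g h
      have hf : ∀ i, X ∣ f i := by
        intro i
        rw [X_dvd_iff]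
        refine ha (fun i => (f i).coeff 0) ?_ i
        have := congrArg (fun p => coeff p 0) h
        simpa [finsetSum_coeff, mul_coeff_zero] using this
      choose f' hf' using hf
      have h2 : X * ∑ i, a i * (f' i * f' i) + ∑ j, b j * (g j * g j) = 0 := by
        apply mul_left_cancel₀ (X_ne_zero (R := S))
        rw [mul_zero, ← h, mul_add]
        congr 1
        rw [← mul_assoc, Finset.mul_sum]
        refine Finset.sum_congr rfl fun i _ => ?_
        rw [hf' i]; ring
      have hg : ∀ i, X ∣ g i := by
        intro i
        rw [X_dvd_iff]
        refine hb (fun i => (g i).coeff 0) ?_ i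
        have := congrArg (fun p => coeff p 0) h2
        simpa [finsetSum_coeff, mul_coeff_zero] using this
      choose g' hg' using hg
      have h3 : ∑ i, a i * (f' i * f' i) + X * ∑ j, b j * (g' j * g' j) = 0 := by
        apply mul_left_cancel₀ (X_ne_zero (R := S))
        rw [mul_zero, ← h2, mul_add]
        congr 1
        rw [← mul_assoc, Finset.mul_sum]
        refine Finset.sum_congr rfl fun i _ => ?_
        rw [hg' i]; ring
      obtain ⟨h4, h5⟩ := ih f' g' h3
      refine ⟨fun i => ?_, fun j => ?_⟩
      · rw [hf' i, pow_succ']; exact mul_dvd_mul_left _ (h4 i)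
      · rw [hg' j, pow_succ']; exact mul_dvd_mul_left _ (h5 j)
  have zero : ∀ p : S[X], (∀ n : ℕ, X ^ n ∣ p) → p = 0 := by
    intro p hp
    ext d
    exact (X_pow_dvd_iff.1 (hp (d + 1))) d (Nat.lt_succ_self d)
  intro f hf
  have h := fun n => key n (fun i => f (Sum.inl i)) (fun j => f (Sum.inr j)) (by
    rw [← hf, Fintype.sum_sum_type, Finset.mul_sum]
    simp [mul_assoc])
  rintro (i | j)
  · exact zero _ fun n => (h n).1 i
  · exact zero _ fun n => (h n).2 j

theorem Aniso.congr {R ι : Type} [CommRing R] [Fintype ι] {a b : ι → R}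
    (h : Aniso a) (e : ∀ i, b i = a i) : Aniso b := by
  have : b = a := funext e
  rwa [this]

theorem Aniso.neg {R ι : Type} [CommRing R] [Fintype ι] {a : ι → R}
    (h : Aniso a) : Aniso (fun i => - a i) := by
  intro f hf
  refine h f ?_
  simpa using hf

theorem aniso_two {k ι : Type} [Field k] [Fintype ι] (q : ι → k) (hq : Aniso q) :
    Aniso (Sum.elim (fun j => (MvPolynomial.X 0 + 1) * MvPolynomial.C (q j))
      (fun j => - MvPolynomial.X 0 * MvPolynomial.C (q j)) : ι ⊕ ι → MvPolynomial (Fin 1) k) ∧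
    Aniso (Sum.elim (fun j => MvPolynomial.C (q j))
      (fun j => MvPolynomial.X 0 * MvPolynomial.C (q j)) : ι ⊕ ι → MvPolynomial (Fin 1) k) := by
  have h0 : Aniso (fun j => (MvPolynomial.C (q j) : MvPolynomial (Fin 0) k)) := by
    refine Aniso.of_inj (MvPolynomial.isEmptyRingEquiv k (Fin 0)).toRingHom
      (MvPolynomial.isEmptyRingEquiv k (Fin 0)).injective ?_
    refine hq.congr fun j => ?_
    exact (MvPolynomial.isEmptyRingEquiv k (Fin 0)).apply_symm_apply (q j)
  constructor
  · refine Aniso.of_inj (MvPolynomial.finSuccEquiv k 0).toRingEquiv.toRingHom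
      (MvPolynomial.finSuccEquiv k 0).injective ?_
    refine (aniso_poly
      (fun j => (Polynomial.X + 1) * Polynomial.C (MvPolynomial.C (q j)))
      (fun j => - Polynomial.C (MvPolynomial.C (q j))) ?_ ?_).congr ?_
    · exact h0.congr fun j => by simp [Polynomial.mul_coeff_zero]
    · exact h0.neg.congr fun j => by simp
    · rintro (j | j) <;> simp [MvPolynomial.finSuccEquiv_apply]
  · refine Aniso.of_inj (MvPolynomial.finSuccEquiv k 0).toRingEquiv.toRingHom
      (MvPolynomial.finSuccEquiv k 0).injective ?_
    refine (aniso_poly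
      (fun j => Polynomial.C (MvPolynomial.C (q j)))
      (fun j => Polynomial.C (MvPolynomial.C (q j))) ?_ ?_).congr ?_
    · exact h0.congr fun j => by simp
    · exact h0.congr fun j => by simp
    · rintro (j | j) <;> simp [MvPolynomial.finSuccEquiv_apply]

theorem aniso_four {k ι : Type} [Field k] [Fintype ι] (q : ι → k) (hq : Aniso q) :
    Aniso (Sum.elim
      (Sum.elim (fun j => (MvPolynomial.X 1 + 1) * MvPolynomial.C (q j))
        (fun j => (- MvPolynomial.X 0 - MvPolynomial.X 1) * MvPolynomial.C (q j)))
      (Sum.elim (fun j => MvPolynomial.X 0 * MvPolynomial.C (q j))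
        (fun j => MvPolynomial.X 0 * MvPolynomial.X 1 * MvPolynomial.C (q j))) :
      (ι ⊕ ι) ⊕ (ι ⊕ ι) → MvPolynomial (Fin 2) k) := by
  obtain ⟨h1, h2⟩ := aniso_two q hq
  refine Aniso.of_inj (MvPolynomial.finSuccEquiv k 1).toRingEquiv.toRingHom
      (MvPolynomial.finSuccEquiv k 1).injective ?_
  refine (aniso_poly
      (Sum.elim (fun j => (Polynomial.C (MvPolynomial.X 0) + 1) *
          Polynomial.C (MvPolynomial.C (q j)))
        (fun j => (- Polynomial.X - Polynomial.C (MvPolynomial.X 0)) *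
          Polynomial.C (MvPolynomial.C (q j))))
      (Sum.elim (fun j => Polynomial.C (MvPolynomial.C (q j)))
        (fun j => Polynomial.C (MvPolynomial.X 0) * Polynomial.C (MvPolynomial.C (q j))))
      ?_ ?_).congr ?_
  · refine h1.congr ?_
    rintro (j | j) <;> simp [Polynomial.mul_coeff_zero]
  · refine h2.congr ?_
    rintro (j | j) <;> simp [Polynomial.mul_coeff_zero]
  · have e : MvPolynomial.finSuccEquiv k 1 (MvPolynomial.X 1) =
        Polynomial.C (MvPolynomial.X 0) := MvPolynomial.finSuccEquiv_X_succ (j := 0)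
    have e0 : MvPolynomial.finSuccEquiv k 1 (MvPolynomial.X 0) = Polynomial.X :=
      MvPolynomial.finSuccEquiv_X_zero
    have e1 : ∀ c : k, MvPolynomial.finSuccEquiv k 1 (MvPolynomial.C c) =
        Polynomial.C (MvPolynomial.C c) := fun c => by simp [MvPolynomial.finSuccEquiv_apply]
    rintro ((j | j) | (j | j)) <;>
      simp [e, e0, e1, mul_assoc]

theorem Aniso.frac {R ι : Type} [CommRing R] [IsDomain R] [Fintype ι] {a : ι → R}
    (h : Aniso a) : Aniso (fun i => algebraMap R (FractionRing R) (a i)) := by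
  intro f hf i
  obtain ⟨b, hb⟩ := IsLocalization.exist_integer_multiples_of_finite (nonZeroDivisors R) f
  choose g hg using hb
  have hb0 : algebraMap R (FractionRing R) b ≠ 0 :=
    IsFractionRing.to_map_ne_zero_of_mem_nonZeroDivisors b.2
  have hg' : ∀ i, algebraMap R (FractionRing R) (g i) =
      algebraMap R (FractionRing R) b * f i := by
    intro i; rw [hg i, Algebra.smul_def]
  have : g i = 0 := by
    refine h g ?_ i
    apply IsFractionRing.injective R (FractionRing R)
    rw [map_zero, map_sum]
    calc _ = (algebraMap R (FractionRing R) b * algebraMap R (FractionRing R) b) *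
          ∑ i, algebraMap R (FractionRing R) (a i) * (f i * f i) := by
          rw [Finset.mul_sum]
          refine Finset.sum_congr rfl fun i _ => ?_
          rw [map_mul, map_mul, hg' i]; ring
      _ = 0 := by rw [hf, mul_zero]
  have h2 := hg' i
  rw [this, map_zero] at h2
  exact (mul_eq_zero.1 h2.symm).resolve_left hb0

/-- **Lemma (anisotropic tensor product).**  Let `k` be any field of characteristic ≠ 2,
and let `q` be any anisotropic quadratic form over `k`.  Then over `k(x₁, x₂)` the
quadratic form `φ = ⟨x₂ + 1, -x₁ - x₂, x₁, x₁x₂⟩ ⊗ q` is anisotropic. -/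
theorem statement1 (k : Type) [Field k] (hchar : ringChar k ≠ 2)
    (n : ℕ) (q : Fin n → k) (hq : (diagQF k q).Anisotropic) :
    (diagQF (L2 k) (fun p : Fin 4 × Fin n =>
      ![xvar k 1 + 1, -xvar k 0 - xvar k 1, xvar k 0, xvar k 0 * xvar k 1] p.1 *
        constMap k (q p.2))).Anisotropic := by
  have hq' : Aniso q := by
    intro f hf i
    have := hq f (by simpa [diagQF, QuadraticMap.weightedSumSquares_apply] using hf)
    exact congrFun this i
  have h := (aniso_four q hq').frac
  intro f hf
  have h' := h (Sum.elim (Sum.elim (fun j => f (0, j)) (fun j => f (1, j)))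
    (Sum.elim (fun j => f (2, j)) (fun j => f (3, j)))) (by
      rw [← hf]
      simp [diagQF, QuadraticMap.weightedSumSquares_apply, Fintype.sum_prod_type,
        Fin.sum_univ_four, Fintype.sum_sum_type, xvar, constMap, add_assoc])
  funext ⟨i, j⟩
  fin_cases i
  · exact h' (.inl (.inl j))
  · exact h' (.inl (.inr j))
  · exact h' (.inr (.inl j))
  · exact h' (.inr (.inr j))
end
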